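/- arXiv:2404.14891 — 2 statements merged into one kernel-verified Lean document; each statement's English description precedes it below -/
import Mathlib

section
/- (Gleason's theorem, finite-dimensional case, as used in Theorem 1 of the paper.) Let n ≥ 3 and let f be a real-valued function on the orthogonal projections of ℂ^n such that 0 ≤ f(P) ≤ 1 for all P, f(1) = 1 for the identity matrix, and f(P + Q) = f(P) + f(Q) whenever P and Q are orthogonal projections with P * Q = 0. Then there exists a unique density matrix ρ on ℂ^n such that f(P) = Re(trace(ρ * P)) for every orthogonal projection P. -/
open Matrix ComplexOrder

namespace Gleason

/-- A frame function of weight `W` on `ℝ³`, viewed as a function of nonzero vectors which is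
invariant under scaling and sums to `W` over every orthogonal basis. -/
structure IsFrameFn (f : (Fin 3 → ℝ) → ℝ) (W : ℝ) : Prop where
  smul : ∀ (t : ℝ) (v : Fin 3 → ℝ), t ≠ 0 → f (t • v) = f v
  sum : ∀ u v w : Fin 3 → ℝ, u ≠ 0 → v ≠ 0 → w ≠ 0 →
    u ⬝ᵥ v = 0 → u ⬝ᵥ w = 0 → v ⬝ᵥ w = 0 → f u + f v + f w = W

theorem IsFrameFn.coplanar {f : (Fin 3 → ℝ) → ℝ} {W : ℝ} (hf : IsFrameFn f W)
    (n u v u' v' : Fin 3 → ℝ) (hn : n ≠ 0) (hu : u ≠ 0) (hv : v ≠ 0) (hu' : u' ≠ 0) (hv' : v' ≠ 0)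
    (huv : u ⬝ᵥ v = 0) (huv' : u' ⬝ᵥ v' = 0) (hun : u ⬝ᵥ n = 0) (hvn : v ⬝ᵥ n = 0)
    (hun' : u' ⬝ᵥ n = 0) (hvn' : v' ⬝ᵥ n = 0) : f u + f v = f u' + f v' := by
  have h1 := hf.sum u v n hu hv hn huv hun hvn
  have h2 := hf.sum u' v' n hu' hv' hn huv' hun' hvn'
  linarith

theorem vec_ne_zero_of_sq {x y z : ℝ} (h : 0 < x ^ 2 + y ^ 2 + z ^ 2) :
    (![x, y, z] : Fin 3 → ℝ) ≠ 0 := by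
  intro h0
  have hx := congrFun h0 0
  have hy := congrFun h0 1
  have hz := congrFun h0 2
  simp at hx hy hz
  subst hx hy hz
  simp at h

/-- A frame function of weight `A` that vanishes on the equator and is bounded below by `-η`. -/
structure IsPolar (φ : (Fin 3 → ℝ) → ℝ) (A η : ℝ) : Prop where
  frame : IsFrameFn φ A
  equator : ∀ x y : ℝ, 0 < x ^ 2 + y ^ 2 → φ ![x, y, 0] = 0
  lower : ∀ v : Fin 3 → ℝ, v ≠ 0 → -η ≤ φ v

/-- The values of `φ` on the open northern hemisphere, in the gnomonic chart. -/
noncomputable def chart (φ : (Fin 3 → ℝ) → ℝ) (z : ℂ) : ℝ := φ ![z.re, z.im, 1]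

namespace IsPolar

variable {φ : (Fin 3 → ℝ) → ℝ} {A η : ℝ}

theorem chart_lower (h : IsPolar φ A η) (z : ℂ) : -η ≤ chart φ z :=
  h.lower _ (vec_ne_zero_of_sq (by positivity))

theorem chart_zero (h : IsPolar φ A η) : chart φ 0 = A := by
  have h1 := h.frame.sum ![1, 0, 0] ![0, 1, 0] ![0, 0, 1]
    (vec_ne_zero_of_sq (by norm_num)) (vec_ne_zero_of_sq (by norm_num))
    (vec_ne_zero_of_sq (by norm_num)) (by simp)
    (by simp) (by simp)
  rw [h.equator 1 0 (by norm_num), h.equator 0 1 (by norm_num)] at h1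
  simpa [chart] using h1

theorem chart_split (h : IsPolar φ A η) {z : ℂ} (hz : z ≠ 0) {t : ℝ} (ht : t ≠ 0) :
    chart φ (z * (1 + t * Complex.I)) +
      chart φ (z * (1 - ((1 + Complex.normSq z) / (t * Complex.normSq z) : ℝ) * Complex.I)) =
      chart φ z := by
  obtain ⟨x, y⟩ := z
  have hpos : 0 < x ^ 2 + y ^ 2 := by
    have := Complex.normSq_pos.2 hz
    simp [Complex.normSq_apply] at this
    nlinarith
  set κ : ℝ := (1 + Complex.normSq ⟨x, y⟩) / (t * Complex.normSq ⟨x, y⟩) with hκ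
  have hκ' : κ * (t * (x ^ 2 + y ^ 2)) = 1 + (x ^ 2 + y ^ 2) := by
    rw [hκ, Complex.normSq_apply]
    have : x * x + y * y ≠ 0 := by nlinarith
    field_simp
  have key := h.frame.coplanar ![-x, -y, x ^ 2 + y ^ 2] ![x - t * y, y + t * x, 1]
    ![x + κ * y, y - κ * x, 1] ![x, y, 1] ![-y, x, 0]
    (vec_ne_zero_of_sq (by positivity)) (vec_ne_zero_of_sq (by positivity))
    (vec_ne_zero_of_sq (by positivity)) (vec_ne_zero_of_sq (by positivity))
    (vec_ne_zero_of_sq (by nlinarith))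
    (by simp; linear_combination -hκ')
    (by simp; ring) (by simp; ring)
    (by simp; ring) (by simp; ring)
    (by simp; ring)
  rw [h.equator (-y) x (by nlinarith), add_zero] at key
  rw [show chart φ ⟨x, y⟩ = φ ![x, y, 1] from rfl, ← key]
  simp only [chart]
  congr 3
  · simp; ring
  · simp; ring
  · simp; ring
  · simp; ring

theorem chart_antipode (h : IsPolar φ A η) {z : ℂ} (hz : z ≠ 0) :
    chart φ z + chart φ (-z / (Complex.normSq z : ℝ)) = A := by
  obtain ⟨x, y⟩ := z
  have hpos : 0 < x ^ 2 + y ^ 2 := by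
    have := Complex.normSq_pos.2 hz
    simp [Complex.normSq_apply] at this
    nlinarith
  have hne : x ^ 2 + y ^ 2 ≠ 0 := hpos.ne'
  have hn : Complex.normSq ⟨x, y⟩ = x ^ 2 + y ^ 2 := by simp [Complex.normSq_apply]; ring
  rw [hn]
  have key := h.frame.sum ![x, y, 1] ![-x / (x ^ 2 + y ^ 2), -y / (x ^ 2 + y ^ 2), 1] ![-y, x, 0]
    (vec_ne_zero_of_sq (by positivity)) (vec_ne_zero_of_sq (by positivity))
    (vec_ne_zero_of_sq (by nlinarith))
    (by simp; field_simp; ring)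
    (by simp; ring) (by simp; ring)
  rw [h.equator (-y) x (by nlinarith), add_zero] at key
  rw [← key]
  simp only [chart]
  congr 3
  · rw [Complex.div_ofReal_re]; simp
  · rw [Complex.div_ofReal_im]; simp

theorem chart_conj_pair (h : IsPolar φ A η) (d e : ℝ) (hde : e ^ 2 = 1 + d ^ 2) :
    chart φ ⟨d, e⟩ + chart φ ⟨d, -e⟩ = chart φ d := by
  have key := h.frame.coplanar ![-1, 0, d] ![d, e, 1] ![d, -e, 1] ![d, 0, 1] ![0, 1, 0]
    (vec_ne_zero_of_sq (by positivity)) (vec_ne_zero_of_sq (by positivity))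
    (vec_ne_zero_of_sq (by positivity)) (vec_ne_zero_of_sq (by positivity))
    (vec_ne_zero_of_sq (by norm_num))
    (by simp; linear_combination -hde)
    (by simp) (by simp)
    (by simp) (by simp)
    (by simp)
  rw [h.equator 0 1 (by norm_num), add_zero] at key
  simpa [chart] using key

theorem chart_le_add (h : IsPolar φ A η) (z : ℂ) : chart φ z ≤ A + η := by
  rcases eq_or_ne z 0 with rfl | hz
  · have h1 := h.chart_lower 0
    have h2 := h.lower ![1, 0, 0] (vec_ne_zero_of_sq (by norm_num))
    rw [h.equator 1 0 (by norm_num)] at h2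
    rw [h.chart_zero]; linarith
  · have h1 := h.chart_antipode hz
    have h2 := h.chart_lower (-z / (Complex.normSq z : ℝ))
    linarith

theorem nonneg (h : IsPolar φ A η) : 0 ≤ η := by
  have h2 := h.lower ![1, 0, 0] (vec_ne_zero_of_sq (by norm_num))
  rw [h.equator 1 0 (by norm_num)] at h2
  linarith

theorem chart_step (h : IsPolar φ A η) (z : ℂ) (t : ℝ) :
    chart φ (z * (1 + t * Complex.I)) ≤ chart φ z + η := by
  have := h.nonneg
  rcases eq_or_ne z 0 with rfl | hz
  · simpa using this
  rcases eq_or_ne t 0 with rfl | ht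
  · simpa using this
  have h1 := h.chart_split hz ht
  have h2 := h.chart_lower (z * (1 - ((1 + Complex.normSq z) / (t * Complex.normSq z) : ℝ)
    * Complex.I))
  linarith

theorem chart_step_pow (h : IsPolar φ A η) (z : ℂ) (t : ℝ) (n : ℕ) :
    chart φ (z * (1 + t * Complex.I) ^ n) ≤ chart φ z + n * η := by
  induction n with
  | zero => simp
  | succ n ih =>
    have h1 := h.chart_step (z * (1 + t * Complex.I) ^ n) t
    rw [pow_succ, ← mul_assoc]
    push_cast
    linarith

theorem chart_radial (h : IsPolar φ A η) (z : ℂ) {c : ℝ} (hc : 1 ≤ c) :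
    chart φ (z * c) ≤ chart φ z + 2 * η := by
  have h1 := h.chart_step z (√(c - 1))
  have h2 := h.chart_step (z * (1 + (√(c - 1) : ℝ) * Complex.I)) (-√(c - 1))
  have h3 : z * (1 + (√(c - 1) : ℝ) * Complex.I) * (1 + ((-√(c - 1) : ℝ) : ℂ) * Complex.I)
      = z * c := by
    have : ((√(c - 1) : ℝ) : ℂ) ^ 2 = c - 1 := by
      rw [← Complex.ofReal_pow, Real.sq_sqrt (by linarith)]; push_cast; ring
    push_cast
    linear_combination z * this - z * ((√(c - 1) : ℝ) : ℂ) ^ 2 * Complex.I_sq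
  rw [h3] at h2
  linarith

end IsPolar

theorem exists_nat_cos_pow {l : ℝ} (hl : 1 < l) :
    ∃ n : ℕ, 2 < n ∧ ∀ θ : ℝ, |θ| ≤ Real.pi →
      0 < Real.cos (θ / n) ∧ 1 ≤ l * Real.cos (θ / n) ^ n := by
  obtain ⟨n, hn⟩ := exists_nat_gt (max 5 (8 * l / (l - 1)))
  have hn5 : (5 : ℝ) < n := lt_of_le_of_lt (le_max_left _ _) hn
  have hn8 : 8 * l / (l - 1) < n := lt_of_le_of_lt (le_max_right _ _) hn
  refine ⟨n, by exact_mod_cast (by linarith : (2 : ℝ) < n), fun θ hθ => ?_⟩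
  have hθ2 : θ ^ 2 ≤ 16 := by
    have := Real.pi_le_four
    rw [← sq_abs]; nlinarith [abs_nonneg θ]
  have hn0 : (0 : ℝ) < n := by linarith
  have hcos := Real.one_sub_sq_div_two_le_cos (x := θ / n)
  have hx : (θ / n) ^ 2 / 2 ≤ 8 / n ^ 2 := by
    rw [div_pow, div_div, div_le_div_iff₀ (by positivity) (by positivity)]
    nlinarith [sq_nonneg (n : ℝ)]
  have h8 : (8 : ℝ) / n ^ 2 < 1 := by
    rw [div_lt_one (by positivity)]; nlinarith
  refine ⟨by linarith, ?_⟩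
  have hb := one_add_mul_le_pow (a := -(8 / (n : ℝ) ^ 2)) (by linarith) n
  have hp : (1 + -(8 / (n : ℝ) ^ 2)) ^ n ≤ Real.cos (θ / n) ^ n :=
    pow_le_pow_left₀ (by linarith) (by linarith) n
  have he : 1 + (n : ℝ) * -(8 / (n : ℝ) ^ 2) = 1 - 8 / n := by field_simp; ring
  have h3 : 1 ≤ l * (1 - 8 / n) := by
    rw [div_lt_iff₀ (by linarith)] at hn8
    have : l * (1 - 8 / n) - 1 = (n * (l - 1) - 8 * l) / n := by field_simp; ring
    have : 0 ≤ (n * (l - 1) - 8 * l) / n := div_nonneg (by linarith) hn0.le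
    linarith
  nlinarith

theorem exists_chart_le_of_mul_norm_le {l : ℝ} (hl : 1 < l) :
    ∃ N : ℕ, 1 ≤ N ∧ ∀ (φ : (Fin 3 → ℝ) → ℝ) (A η : ℝ), IsPolar φ A η → ∀ z w : ℂ, w ≠ 0 →
      l * ‖z‖ ≤ ‖w‖ → chart φ w ≤ chart φ z + N * η := by
  obtain ⟨n, hn2, hn⟩ := exists_nat_cos_pow hl
  refine ⟨n + 2, by omega, fun φ A η h z w hw hzw => ?_⟩
  have hη := h.nonneg
  rcases eq_or_ne z 0 with rfl | hz
  · have := h.chart_le_add w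
    rw [h.chart_zero]
    push_cast
    nlinarith [(Nat.cast_nonneg n : (0 : ℝ) ≤ n)]
  set u := w / z with hu
  obtain ⟨hc0, hc⟩ := hn u.arg (Complex.abs_arg_le_pi u)
  have hn0 : (n : ℂ) ≠ 0 := by exact_mod_cast (by omega : n ≠ 0)
  set α := u.arg / n with hα
  have hstep := h.chart_step_pow z (Real.tan α) n
  have hnu : l ≤ ‖u‖ := by
    rw [hu, norm_div, le_div_iff₀ (norm_pos_iff.2 hz)]; exact hzw
  have hcc : 1 ≤ ‖u‖ * Real.cos α ^ n := by
    have : 0 < Real.cos α ^ n := pow_pos hc0 n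
    nlinarith
  have hrad := h.chart_radial (z * (1 + (Real.tan α : ℝ) * Complex.I) ^ n) hcc
  have hcα : (Complex.cos α) ≠ 0 := by
    rw [← Complex.ofReal_cos]; exact_mod_cast hc0.ne'
  have e1 : (1 + (Real.tan α : ℝ) * Complex.I) = Complex.exp (α * Complex.I) / Complex.cos α := by
    rw [Complex.exp_mul_I, Complex.ofReal_tan, Complex.tan_eq_sin_div_cos]
    field_simp
  have e2 : z * (1 + (Real.tan α : ℝ) * Complex.I) ^ n * ((‖u‖ * Real.cos α ^ n : ℝ) : ℂ) = w := by
    rw [e1, div_pow, ← Complex.exp_nat_mul]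
    push_cast
    have e3 : (n : ℂ) * (α * Complex.I) = u.arg * Complex.I := by
      rw [hα]; push_cast; field_simp
    rw [e3]
    have e4 : z * (Complex.exp (u.arg * Complex.I) / Complex.cos α ^ n) *
        (‖u‖ * Complex.cos α ^ n) = z * (‖u‖ * Complex.exp (u.arg * Complex.I)) := by
      field_simp
    rw [e4, Complex.norm_mul_exp_arg_mul_I, hu]
    field_simp
  rw [e2] at hrad
  push_cast
  linarith

theorem exists_chart_le_two_pow (k : ℕ) :
    ∃ N : ℕ, ∀ (φ : (Fin 3 → ℝ) → ℝ) (A η : ℝ), IsPolar φ A η → ∀ z : ℂ,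
      3 ^ k - 1 ≤ Complex.normSq z → chart φ z ≤ A / 2 ^ k + N * η := by
  obtain ⟨N, hN1, hN⟩ := exists_chart_le_of_mul_norm_le (l := 6 / 5) (by norm_num)
  induction k with
  | zero => exact ⟨1, fun φ A η h z _ => by simpa using h.chart_le_add z⟩
  | succ k ih =>
    obtain ⟨K, hK⟩ := ih
    refine ⟨K + N, fun φ A η h z hz => ?_⟩
    have h3 : (1 : ℝ) ≤ 3 ^ k := one_le_pow₀ (by norm_num)
    set d := √((3 : ℝ) ^ k - 1) with hd
    set e := √((3 : ℝ) ^ k) with he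
    have hd2 : d ^ 2 = 3 ^ k - 1 := Real.sq_sqrt (by linarith)
    have he2 : e ^ 2 = 3 ^ k := Real.sq_sqrt (by linarith)
    have hpair := h.chart_conj_pair d e (by rw [hd2, he2]; ring)
    have hd' := hK φ A η h d (by simp [Complex.normSq_apply]; nlinarith)
    rw [pow_succ] at hz
    have hz0 : z ≠ 0 := by
      rintro rfl
      simp at hz
      linarith
    have hn : ∀ y : ℂ, Complex.normSq y = 2 * 3 ^ k - 1 → 6 / 5 * ‖y‖ ≤ ‖z‖ := by
      intro y hy
      rw [Complex.normSq_eq_norm_sq] at hy hz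
      apply le_of_sq_le_sq _ (norm_nonneg z)
      rw [mul_pow]; nlinarith
    have h1 := hN φ A η h ⟨d, e⟩ z hz0 (hn _ (by simp [Complex.normSq_apply]; nlinarith))
    have h2 := hN φ A η h ⟨d, -e⟩ z hz0 (hn _ (by simp [Complex.normSq_apply]; nlinarith))
    have h4 : A / 2 ^ (k + 1) = A / 2 ^ k / 2 := by rw [pow_succ, div_div]
    have := h.nonneg
    have hKn : 0 ≤ K * η := by positivity
    rw [h4]
    push_cast
    linarith

theorem exists_le_chart_of_normSq_le (k : ℕ) :
    ∃ N : ℕ, ∀ (φ : (Fin 3 → ℝ) → ℝ) (A η : ℝ), IsPolar φ A η → ∀ z : ℂ,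
      Complex.normSq z * 3 ^ k ≤ 1 → A - |A| / 2 ^ k - N * η ≤ chart φ z := by
  obtain ⟨N, hN⟩ := exists_chart_le_two_pow k
  refine ⟨N, fun φ A η h z hz => ?_⟩
  have := h.nonneg
  have hA : A / 2 ^ k ≤ |A| / 2 ^ k := by gcongr; exact le_abs_self A
  rcases eq_or_ne z 0 with rfl | hz0
  · rw [h.chart_zero]
    have : 0 ≤ |A| / 2 ^ k := by positivity
    have : 0 ≤ N * η := by positivity
    linarith
  · have h1 := h.chart_antipode hz0
    have hp := Complex.normSq_pos.2 hz0
    have h2 := hN φ A η h (-z / (Complex.normSq z : ℝ)) (by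
      rw [Complex.normSq_div, Complex.normSq_neg, Complex.normSq_ofReal]
      rw [mul_comm, ← le_div_iff₀ hp] at hz
      have : Complex.normSq z / (Complex.normSq z * Complex.normSq z) = 1 / Complex.normSq z := by
        field_simp
      rw [this]; linarith)
    linarith

theorem eq_mul_of_additive {F : ℝ → ℝ}
    (hadd : ∀ a b : ℝ, 0 < a → 0 < b → a + b ≤ 1 → F (a + b) = F a + F b)
    (hnn : ∀ a : ℝ, 0 < a → a ≤ 1 → 0 ≤ F a) {x : ℝ} (hx : 0 < x) (hx1 : x ≤ 1) :
    F x = x * F 1 := by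
  have hmono : ∀ a b : ℝ, 0 < a → a ≤ b → b ≤ 1 → F a ≤ F b := by
    intro a b ha hab hb
    rcases hab.eq_or_lt with rfl | hlt
    · rfl
    have := hadd a (b - a) ha (by linarith) (by linarith)
    rw [add_sub_cancel] at this
    have := hnn (b - a) (by linarith) (by linarith)
    linarith
  have hmul : ∀ (k : ℕ) (a : ℝ), 0 < a → (k + 1) * a ≤ 1 → F ((k + 1) * a) = (k + 1) * F a := by
    intro k a ha
    induction k with
    | zero => simp
    | succ k ih =>
      intro h
      push_cast at h ⊢
      have h1 := ih (by nlinarith)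
      have h2 := hadd ((k + 1) * a) a (by positivity) ha (by linarith)
      rw [show ((k : ℝ) + 1 + 1) * a = (k + 1) * a + a by ring, h2, h1]
      ring
  have hF1 := hnn 1 one_pos le_rfl
  have hbound : ∀ n : ℕ, |F x - x * F 1| ≤ F 1 / (n + 1) := by
    intro n
    have hn : (0 : ℝ) < n + 1 := by positivity
    have hinv : F (1 / (n + 1)) = F 1 / (n + 1) := by
      have := hmul n (1 / (n + 1)) (by positivity) (by field_simp; rfl)
      rw [mul_one_div_cancel hn.ne'] at this
      rw [this]; field_simp
    have hval : ∀ k : ℕ, k + 1 ≤ n + 1 → F ((k + 1) / (n + 1)) = (k + 1) * (F 1 / (n + 1)) := by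
      intro k hk
      have hk' : (k : ℝ) + 1 ≤ n + 1 := by exact_mod_cast hk
      have := hmul k (1 / (n + 1)) (by positivity) (by
        rw [mul_one_div, div_le_one hn]; exact hk')
      rw [mul_one_div, hinv] at this
      exact this
    set m := ⌊(n + 1) * x⌋₊ with hm
    have hm1 : (m : ℝ) ≤ (n + 1) * x := Nat.floor_le (by positivity)
    have hm2 : (n + 1) * x < m + 1 := Nat.lt_floor_add_one _
    have hlow : m * (F 1 / (n + 1)) ≤ F x := by
      rcases Nat.eq_zero_or_pos m with h0 | h0
      · rw [h0]; simpa using hnn x hx hx1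
      · obtain ⟨j, hj⟩ := Nat.exists_eq_succ_of_ne_zero h0.ne'
        have hj' : (m : ℝ) = j + 1 := by rw [hj]; push_cast; ring
        have hle : ((j : ℝ) + 1) / (n + 1) ≤ x := by
          rw [div_le_iff₀ hn, ← hj']; linarith
        have hjn : j + 1 ≤ n + 1 := by
          have : (j : ℝ) + 1 ≤ n + 1 := by rw [← hj']; nlinarith
          exact_mod_cast this
        rw [hj', ← hval j hjn]
        exact hmono _ _ (by positivity) hle hx1
    have hup : F x ≤ (m + 1) * (F 1 / (n + 1)) := by
      by_cases hmn : m + 1 ≤ n + 1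
      · rw [← hval m hmn]
        refine hmono _ _ hx (by rw [le_div_iff₀ hn]; linarith) ?_
        rw [div_le_one hn]; exact_mod_cast hmn
      · have : (n : ℝ) + 1 ≤ m := by exact_mod_cast (by omega : n + 1 ≤ m)
        have h1 := hmono x 1 hx hx1 le_rfl
        have h2 : F 1 = (n + 1) * (F 1 / (n + 1)) := by field_simp
        have : 0 ≤ F 1 / (n + 1) := by positivity
        nlinarith
    have hc : 0 ≤ F 1 / (n + 1) := by positivity
    have h2 : x * F 1 = ((n + 1) * x) * (F 1 / (n + 1)) := by field_simp
    rw [abs_le]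
    constructor <;> nlinarith
  have hlim : Filter.Tendsto (fun n : ℕ => F 1 / ((n : ℝ) + 1)) Filter.atTop (nhds 0) := by
    have := (tendsto_one_div_add_atTop_nhds_zero_nat (𝕜 := ℝ)).const_mul (F 1)
    simpa [div_eq_mul_inv] using this
  have := ge_of_tendsto' hlim hbound
  have := abs_nonpos_iff.1 this
  linarith

namespace IsPolar

variable {φ : (Fin 3 → ℝ) → ℝ} {A : ℝ}

theorem chart_antitone (h : IsPolar φ A 0) {z w : ℂ} (hzw : ‖z‖ < ‖w‖) :
    chart φ w ≤ chart φ z := by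
  have hw : w ≠ 0 := by
    rintro rfl
    simp at hzw
    linarith [norm_nonneg z]
  rcases eq_or_ne z 0 with rfl | hz
  · rw [h.chart_zero]; simpa using h.chart_le_add w
  · have hz' := norm_pos_iff.2 hz
    obtain ⟨N, -, hN⟩ := exists_chart_le_of_mul_norm_le (l := ‖w‖ / ‖z‖)
      ((one_lt_div hz').2 hzw)
    simpa using hN φ A 0 h z w hw (by rw [div_mul_cancel₀ _ hz'.ne'])

theorem chart_le_of_norm_eq (h : IsPolar φ A 0) {z w : ℂ} (hzw : ‖z‖ = ‖w‖) :
    chart φ w ≤ chart φ z := by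
  rcases eq_or_ne z 0 with rfl | hz
  · rw [norm_zero, eq_comm, norm_eq_zero] at hzw
    rw [hzw]
  have hbound : ∀ k : ℕ, chart φ w - chart φ z ≤ A * (1 / 2) ^ k := by
    intro k
    obtain ⟨N, hN⟩ := exists_chart_le_two_pow k
    have hr := Complex.normSq_pos.2 hz
    have h3 : (1 : ℝ) ≤ 3 ^ k := one_le_pow₀ (by norm_num)
    -- descend from `u` to `z`, where `u` is slightly higher than `z`
    set t : ℝ := √(1 / (3 ^ k)) with ht
    have ht2 : t ^ 2 = 1 / 3 ^ k := Real.sq_sqrt (by positivity)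
    have ht0 : 0 < t := Real.sqrt_pos.2 (by positivity)
    have hI : Complex.normSq (1 + t * Complex.I) = 1 + t ^ 2 := by
      simp [Complex.normSq_apply]; ring
    have hI0 : (1 + t * Complex.I) ≠ 0 := by
      rw [← Complex.normSq_pos, hI]; positivity
    set u := z / (1 + t * Complex.I) with hu
    have hu0 : u ≠ 0 := div_ne_zero hz hI0
    have hun : Complex.normSq u * (1 + t ^ 2) = Complex.normSq z := by
      rw [hu, Complex.normSq_div, hI]
      field_simp
    have hun0 := Complex.normSq_pos.2 hu0
    have huw : ‖u‖ < ‖w‖ := by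
      rw [← hzw]
      apply lt_of_pow_lt_pow_left₀ 2 (norm_nonneg z)
      rw [← Complex.normSq_eq_norm_sq, ← Complex.normSq_eq_norm_sq, ← hun]
      nlinarith [sq_pos_of_pos ht0]
    have h1 := h.chart_split hu0 ht0.ne'
    rw [show u * (1 + t * Complex.I) = z by rw [hu, div_mul_cancel₀ _ hI0]] at h1
    have h2 := h.chart_antitone huw
    have h4 := hN φ A 0 h (u * (1 - ((1 + Complex.normSq u) / (t * Complex.normSq u) : ℝ)
      * Complex.I)) (by
        rw [Complex.normSq_mul]
        generalize Complex.normSq u = r at hun0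
        have : Complex.normSq (1 - ((1 + r) / (t * r) : ℝ) * Complex.I) =
            1 + (1 + r) ^ 2 / (t ^ 2 * r ^ 2) := by
          rw [← mul_pow, ← div_pow]
          simp only [Complex.normSq_apply, Complex.sub_re, Complex.sub_im, Complex.one_re,
            Complex.one_im, Complex.re_ofReal_mul, Complex.im_ofReal_mul, Complex.I_re,
            Complex.I_im]
          ring
        rw [this, ht2]
        have e : r * (1 + (1 + r) ^ 2 / (1 / 3 ^ k * r ^ 2)) =
          r + 3 ^ k * (2 + r) + 3 ^ k / r := by field_simp; ring
        rw [e]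
        have : 0 ≤ 3 ^ k / r := by positivity
        nlinarith)
    have e5 : A / 2 ^ k = A * (1 / 2) ^ k := by rw [one_div, inv_pow]; rfl
    rw [e5] at h4
    simp only [mul_zero, add_zero] at h4
    linarith
  have hlim : Filter.Tendsto (fun k : ℕ => A * (1 / 2 : ℝ) ^ k) Filter.atTop (nhds 0) := by
    have := (tendsto_pow_atTop_nhds_zero_of_lt_one (r := (1 / 2 : ℝ)) (by norm_num)
      (by norm_num)).const_mul A
    simpa using this
  have := ge_of_tendsto' hlim hbound
  linarith

theorem chart_eq_of_normSq_eq (h : IsPolar φ A 0) {z w : ℂ}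
    (hzw : Complex.normSq z = Complex.normSq w) : chart φ w = chart φ z := by
  have : ‖z‖ = ‖w‖ := by
    rw [Complex.normSq_eq_norm_sq, Complex.normSq_eq_norm_sq] at hzw
    exact (pow_left_inj₀ (norm_nonneg _) (norm_nonneg _) two_ne_zero).1 hzw
  exact le_antisymm (h.chart_le_of_norm_eq this) (h.chart_le_of_norm_eq this.symm)

theorem chart_eq (h : IsPolar φ A 0) (z : ℂ) : chart φ z = A / (1 + Complex.normSq z) := by
  set F : ℝ → ℝ := fun l => chart φ (√(1 / l - 1) : ℝ) with hF
  have hchart : ∀ z : ℂ, chart φ z = F (1 / (1 + Complex.normSq z)) := by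
    intro z
    apply h.chart_eq_of_normSq_eq
    have := Complex.normSq_nonneg z
    rw [one_div_one_div, add_sub_cancel_left, Complex.normSq_ofReal, Real.mul_self_sqrt this]
  have hF1 : F 1 = A := by
    rw [← h.chart_zero, hchart]; simp
  have hadd : ∀ a b : ℝ, 0 < a → 0 < b → a + b ≤ 1 → F (a + b) = F a + F b := by
    intro a b ha hb hab
    rcases hab.eq_or_lt with hab | hab
    · set r := √(1 / a - 1) with hr
      have ha1 : a < 1 := by linarith
      have hpos : 0 < 1 / a - 1 := by rw [sub_pos, lt_one_div one_pos ha]; simpa using ha1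
      have hr2 : r ^ 2 = 1 / a - 1 := Real.sq_sqrt hpos.le
      have hr0 : 0 < r := Real.sqrt_pos.2 hpos
      have h1 := h.chart_antipode (z := r) (by exact_mod_cast hr0.ne')
      rw [hab, hF1, ← h1, hchart (-_ / _)]
      congr 2
      rw [Complex.normSq_div, Complex.normSq_neg, Complex.normSq_ofReal, Complex.normSq_ofReal,
        ← pow_two, hr2]
      have : 1 - a = b := by linarith
      have hne : 1 - a ≠ 0 := by linarith
      field_simp
      linarith
    · set r := √(1 / (a + b) - 1) with hr
      have hpos : 0 < 1 / (a + b) - 1 := by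
        rw [sub_pos, lt_one_div one_pos (by positivity)]; simpa using hab
      have hr2 : r ^ 2 = 1 / (a + b) - 1 := Real.sq_sqrt hpos.le
      have hr0 : 0 < r := Real.sqrt_pos.2 hpos
      have hpos' : 0 < (1 / a - 1 / (a + b)) / r ^ 2 := by
        apply div_pos _ (by positivity)
        rw [sub_pos]
        exact one_div_lt_one_div_of_lt ha (by linarith)
      set t := √((1 / a - 1 / (a + b)) / r ^ 2) with ht
      have ht2 : t ^ 2 = (1 / a - 1 / (a + b)) / r ^ 2 := Real.sq_sqrt hpos'.le
      have ht0 : 0 < t := Real.sqrt_pos.2 hpos'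
      have h1 := h.chart_split (z := r) (by exact_mod_cast hr0.ne') ht0.ne'
      rw [show chart φ r = F (a + b) from rfl, hchart (_ * _), hchart (_ * _)] at h1
      rw [← h1]
      have hnI : ∀ s : ℝ, Complex.normSq (1 + s * Complex.I) = 1 + s ^ 2 := by
        intro s; simp [Complex.normSq_apply]; ring
      have hnI' : ∀ s : ℝ, Complex.normSq (1 - s * Complex.I) = 1 + s ^ 2 := by
        intro s; simp [Complex.normSq_apply]; ring
      have hne : 1 - (a + b) ≠ 0 := by linarith
      have htr : t ^ 2 * r ^ 2 = b / (a * (a + b)) := by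
        rw [ht2]; field_simp; ring
      congr 2
      · rw [Complex.normSq_mul, Complex.normSq_ofReal, hnI, ← pow_two]
        have : r ^ 2 * (1 + t ^ 2) = 1 / a - 1 := by
          rw [mul_add, mul_comm _ (t ^ 2), htr, hr2]; field_simp; ring
        rw [this]; field_simp; ring
      · rw [Complex.normSq_mul, Complex.normSq_ofReal, hnI', ← pow_two]
        have : r ^ 2 * (1 + ((1 + r ^ 2) / (t * r ^ 2)) ^ 2) =
            r ^ 2 + (1 + r ^ 2) ^ 2 / (t ^ 2 * r ^ 2) := by field_simp
        rw [this, htr, hr2]; field_simp; ring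
  have hnn : ∀ a : ℝ, 0 < a → a ≤ 1 → 0 ≤ F a := fun a _ _ => by
    have := h.chart_lower (√(1 / a - 1) : ℝ)
    rwa [neg_zero] at this
  have hz := Complex.normSq_nonneg z
  rw [hchart, eq_mul_of_additive hadd hnn (by positivity)
    (by rw [div_le_one (by positivity)]; linarith), hF1]
  ring

theorem eq_mul_sq_div (h : IsPolar φ A 0) {x y z : ℝ} (hv : 0 < x ^ 2 + y ^ 2 + z ^ 2) :
    φ ![x, y, z] = A * z ^ 2 / (x ^ 2 + y ^ 2 + z ^ 2) := by
  rcases eq_or_ne z 0 with rfl | hz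
  · rw [h.equator x y (by linarith)]; simp
  · have h1 := h.frame.smul z ![x / z, y / z, 1] hz
    have h2 : z • (![x / z, y / z, 1] : Fin 3 → ℝ) = ![x, y, z] := by
      ext i; fin_cases i <;> simp <;> field_simp
    rw [h2] at h1
    rw [h1]
    have h3 := h.chart_eq ⟨x / z, y / z⟩
    rw [show chart φ ⟨x / z, y / z⟩ = φ ![x / z, y / z, 1] from rfl] at h3
    rw [h3, Complex.normSq_apply]
    field_simp
    congr 1
    ring

end IsPolar

theorem mulVec_dotProduct_mulVec {U : Matrix (Fin 3) (Fin 3) ℝ} (hU : Uᵀ * U = 1)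
    (u v : Fin 3 → ℝ) : (U *ᵥ u) ⬝ᵥ (U *ᵥ v) = u ⬝ᵥ v := by
  rw [Matrix.dotProduct_mulVec, Matrix.vecMul_mulVec, ← Matrix.dotProduct_mulVec, hU,
    Matrix.one_mulVec]

theorem mulVec_ne_zero {U : Matrix (Fin 3) (Fin 3) ℝ} (hU : Uᵀ * U = 1)
    {u : Fin 3 → ℝ} (hu : u ≠ 0) : U *ᵥ u ≠ 0 := by
  intro h
  have := mulVec_dotProduct_mulVec hU u u
  rw [h] at this
  simp only [dotProduct_zero] at this
  exact hu (dotProduct_self_eq_zero.1 this.symm)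

theorem IsFrameFn.comp_mulVec {f : (Fin 3 → ℝ) → ℝ} {W : ℝ} (hf : IsFrameFn f W)
    {U : Matrix (Fin 3) (Fin 3) ℝ} (hU : Uᵀ * U = 1) : IsFrameFn (fun v => f (U *ᵥ v)) W where
  smul t v ht := by
    simp only [Matrix.mulVec_smul]
    exact hf.smul t _ ht
  sum u v w hu hv hw huv huw hvw :=
    hf.sum _ _ _ (mulVec_ne_zero hU hu) (mulVec_ne_zero hU hv) (mulVec_ne_zero hU hw)
      (by rw [mulVec_dotProduct_mulVec hU, huv]) (by rw [mulVec_dotProduct_mulVec hU, huw])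
      (by rw [mulVec_dotProduct_mulVec hU, hvw])

theorem exists_orthogonal_matrix {p r : Fin 3 → ℝ} (hp : p ⬝ᵥ p = 1) (hr : r ⬝ᵥ r = 1)
    (hpr : p ⬝ᵥ r = 0) : ∃ U : Matrix (Fin 3) (Fin 3) ℝ, Uᵀ * U = 1 ∧
      U *ᵥ ![1, 0, 0] = p ∧ U *ᵥ ![0, 0, 1] = r := by
  have hrp : r ⬝ᵥ p = 0 := by rw [dotProduct_comm, hpr]
  have h1 : p ⬝ᵥ (p ⨯₃ r) = 0 := dot_self_cross p r
  have h2 : r ⬝ᵥ (p ⨯₃ r) = 0 := dot_cross_self p r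
  have h3 : (p ⨯₃ r) ⬝ᵥ (p ⨯₃ r) = 1 := by
    rw [cross_dot_cross, hp, hr, hpr, hrp]; norm_num
  refine ⟨(Matrix.of ![p, p ⨯₃ r, r])ᵀ, ?_, ?_, ?_⟩
  · ext i j
    rw [Matrix.transpose_transpose, Matrix.mul_apply']
    change ![p, p ⨯₃ r, r] i ⬝ᵥ ![p, p ⨯₃ r, r] j = _
    fin_cases i <;> fin_cases j <;> 
      simp [hp, hr, hpr, hrp, h1, h2, h3, dotProduct_comm (p ⨯₃ r)]
  · ext i; simp [Matrix.mulVec, dotProduct, Fin.sum_univ_three]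
  · ext i; simp [Matrix.mulVec, dotProduct, Fin.sum_univ_three]

theorem exists_unit_orthogonal (p : Fin 3 → ℝ) : ∃ q : Fin 3 → ℝ, q ⬝ᵥ q = 1 ∧ q ⬝ᵥ p = 0 := by
  rcases eq_or_ne (p 0 ^ 2 + p 1 ^ 2) 0 with h0 | h0
  · have : p 0 = 0 := by nlinarith [sq_nonneg (p 1)]
    exact ⟨![1, 0, 0], by simp [dotProduct, Fin.sum_univ_three], by
      simp [dotProduct, Fin.sum_univ_three, this]⟩
  · have hs := Real.sq_sqrt (show 0 ≤ p 0 ^ 2 + p 1 ^ 2 by positivity)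
    set n := √(p 0 ^ 2 + p 1 ^ 2) with hn
    have hn0 : n ≠ 0 := by
      intro h; rw [h] at hs; apply h0; rw [← hs]; norm_num
    refine ⟨![-p 1 / n, p 0 / n, 0], ?_, ?_⟩
    · simp [dotProduct, Fin.sum_univ_three]
      field_simp
      linarith
    · simp [dotProduct, Fin.sum_univ_three]
      ring

theorem exists_orthogonal_matrix_pole {p : Fin 3 → ℝ} (hp : p ⬝ᵥ p = 1) :
    ∃ U : Matrix (Fin 3) (Fin 3) ℝ, Uᵀ * U = 1 ∧ U *ᵥ ![0, 0, 1] = p := by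
  obtain ⟨q, hq, hqp⟩ := exists_unit_orthogonal p
  obtain ⟨U, hU, -, h⟩ := exists_orthogonal_matrix hq hp hqp
  exact ⟨U, hU, h⟩

/-- The symmetrization of `F` under a quarter turn about the third axis. -/
def symmetrize (F : (Fin 3 → ℝ) → ℝ) (k : ℝ) (v : Fin 3 → ℝ) : ℝ :=
  F v + F ![-v 1, v 0, v 2] - k

theorem IsFrameFn.isPolar_symmetrize {F : (Fin 3 → ℝ) → ℝ} {W M : ℝ} (hF : IsFrameFn F W)
    (hM : ∀ v, v ≠ 0 → F v ≤ M) :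
    IsPolar (symmetrize F (W - F ![0, 0, 1])) (3 * F ![0, 0, 1] - W)
      (2 * (M - F ![0, 0, 1])) := by
  set a := F ![0, 0, 1] with ha
  set U : Matrix (Fin 3) (Fin 3) ℝ := !![0, -1, 0; 1, 0, 0; 0, 0, 1] with hUdef
  have hU : Uᵀ * U = 1 := by
    ext i j; fin_cases i <;> fin_cases j <;> simp [hUdef, Matrix.mul_apply, Fin.sum_univ_three]
  have hUv : ∀ v : Fin 3 → ℝ, U *ᵥ v = ![-v 1, v 0, v 2] := by
    intro v
    ext i; fin_cases i <;> simp [hUdef, Matrix.mulVec, dotProduct, Fin.sum_univ_three]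
  have hFU := hF.comp_mulVec hU
  have hs : ∀ v, symmetrize F (W - a) v = F v + F (U *ᵥ v) - (W - a) := by
    intro v; rw [hUv]; rfl
  have hframe : IsFrameFn (symmetrize F (W - a)) (3 * a - W) := by
    constructor
    · intro t v ht
      rw [hs, hs, hF.smul t v ht, hFU.smul t v ht]
    · intro u v w hu hv hw huv huw hvw
      have h1 := hF.sum u v w hu hv hw huv huw hvw
      have h2 := hFU.sum u v w hu hv hw huv huw hvw
      rw [hs, hs, hs]
      linarith
  have heq : ∀ x y : ℝ, 0 < x ^ 2 + y ^ 2 → symmetrize F (W - a) ![x, y, 0] = 0 := by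
    intro x y hxy
    have h1 := hF.sum ![x, y, 0] ![-y, x, 0] ![0, 0, 1] (vec_ne_zero_of_sq (by linarith))
      (vec_ne_zero_of_sq (by linarith)) (vec_ne_zero_of_sq (by norm_num))
      (by simp; ring) (by simp) (by simp)
    rw [hs, hUv]
    simp only [cons_val]
    linarith
  refine ⟨hframe, heq, fun v hv => ?_⟩
  have hle : ∀ v, v ≠ 0 → symmetrize F (W - a) v ≤ 3 * a - W + 2 * (M - a) := by
    intro v hv
    have h1 := hM v hv
    have h2 := hM _ (mulVec_ne_zero hU hv)
    rw [hs]
    linarith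
  have hη : a ≤ M := hM _ (vec_ne_zero_of_sq (by norm_num))
  by_cases h0 : v 0 ^ 2 + v 1 ^ 2 = 0
  · have hx : v 0 = 0 := by nlinarith [sq_nonneg (v 1)]
    have hy : v 1 = 0 := by nlinarith [sq_nonneg (v 0)]
    have hz : v 2 ≠ 0 := by
      intro hz
      apply hv
      ext i; fin_cases i <;> simp [hx, hy, hz]
    have h1 := hframe.sum v ![1, 0, 0] ![0, 1, 0] hv (vec_ne_zero_of_sq (by norm_num))
      (vec_ne_zero_of_sq (by norm_num)) (by simp [dotProduct, Fin.sum_univ_three, hx])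
      (by simp [dotProduct, Fin.sum_univ_three, hy]) (by simp)
    rw [heq 1 0 (by norm_num), heq 0 1 (by norm_num)] at h1
    have h2 := hle ![1, 0, 0] (vec_ne_zero_of_sq (by norm_num))
    rw [heq 1 0 (by norm_num)] at h2
    linarith
  · have hpos : 0 < v 0 ^ 2 + v 1 ^ 2 := lt_of_le_of_ne (by positivity) (Ne.symm h0)
    have hne : (![-(v 0 * v 2), -(v 1 * v 2), v 0 ^ 2 + v 1 ^ 2] : Fin 3 → ℝ) ≠ 0 :=
      vec_ne_zero_of_sq (by positivity)
    have h1 := hframe.sum v ![-(v 0 * v 2), -(v 1 * v 2), v 0 ^ 2 + v 1 ^ 2] ![-v 1, v 0, 0] hv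
      hne (vec_ne_zero_of_sq (by nlinarith))
      (by simp [dotProduct, Fin.sum_univ_three]; ring)
      (by simp [dotProduct, Fin.sum_univ_three]; ring) (by simp; ring)
    rw [heq (-v 1) (v 0) (by nlinarith)] at h1
    have h2 := hle _ hne
    linarith

theorem transpose_mulVec_two {U : Matrix (Fin 3) (Fin 3) ℝ} {p : Fin 3 → ℝ}
    (hp : U *ᵥ ![0, 0, 1] = p) (s : Fin 3 → ℝ) : (Uᵀ *ᵥ s) 2 = s ⬝ᵥ p := by
  rw [← hp, Matrix.dotProduct_mulVec, ← Matrix.mulVec_transpose]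
  simp [dotProduct, Fin.sum_univ_three]

theorem exists_near_pole (C : ℝ) {ε : ℝ} (hε : 0 < ε) :
    ∃ δ K : ℝ, 0 < δ ∧ 0 < K ∧ ∀ (f : (Fin 3 → ℝ) → ℝ) (W M : ℝ), IsFrameFn f W →
      (∀ v, v ≠ 0 → |f v| ≤ C) → (∀ v, v ≠ 0 → f v ≤ M) →
      ∀ p : Fin 3 → ℝ, p ⬝ᵥ p = 1 → M - δ ≤ f p → ∀ s : Fin 3 → ℝ, s ≠ 0 →
        (s ⬝ᵥ s - (s ⬝ᵥ p) ^ 2) * K ≤ (s ⬝ᵥ p) ^ 2 → M - ε ≤ f s := by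
  obtain ⟨k, hk⟩ : ∃ k : ℕ, 6 * C / 2 ^ k < ε / 2 := by
    have hlim : Filter.Tendsto (fun k : ℕ => 6 * C * (1 / 2 : ℝ) ^ k) Filter.atTop (nhds 0) := by
      have := (tendsto_pow_atTop_nhds_zero_of_lt_one (r := (1 / 2 : ℝ)) (by norm_num)
        (by norm_num)).const_mul (6 * C)
      simpa using this
    obtain ⟨k, hk⟩ := (hlim.eventually (gt_mem_nhds (half_pos hε))).exists
    refine ⟨k, ?_⟩
    rw [one_div, inv_pow] at hk
    exact hk
  obtain ⟨N, hN⟩ := exists_le_chart_of_normSq_le k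
  refine ⟨ε / (4 * (N + 1)), 3 ^ k, by positivity, by positivity, ?_⟩
  intro f W M hf hb hM p hp hfp s hs hsp
  obtain ⟨U, hU, hUp⟩ := exists_orthogonal_matrix_pole hp
  have hU' : U * Uᵀ = 1 := mul_eq_one_comm.1 hU
  have hF := hf.comp_mulVec hU
  have hpol := hF.isPolar_symmetrize (M := M) (fun v hv => hM _ (mulVec_ne_zero hU hv))
  rw [hUp] at hpol
  have hp0 : p ≠ 0 := by rintro rfl; simp at hp
  have hW : |W| ≤ 3 * C := by
    have h1 := hF.sum ![1, 0, 0] ![0, 1, 0] ![0, 0, 1]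
      (vec_ne_zero_of_sq (by norm_num)) (vec_ne_zero_of_sq (by norm_num))
      (vec_ne_zero_of_sq (by norm_num)) (by simp) (by simp) (by simp)
    have ha := abs_le.1 (hb _ (mulVec_ne_zero hU (u := ![1, 0, 0])
      (vec_ne_zero_of_sq (by norm_num))))
    have hb' := abs_le.1 (hb _ (mulVec_ne_zero hU (u := ![0, 1, 0])
      (vec_ne_zero_of_sq (by norm_num))))
    have hc := abs_le.1 (hb _ (mulVec_ne_zero hU (u := ![0, 0, 1])
      (vec_ne_zero_of_sq (by norm_num))))
    rw [abs_le]
    constructor <;> linarith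
  have hA : |3 * f p - W| ≤ 6 * C := by
    have h1 := abs_le.1 (hb p hp0)
    have h2 := abs_le.1 hW
    rw [abs_le]
    constructor <;> linarith
  set v := Uᵀ *ᵥ s with hv
  have hsv : s = U *ᵥ v := by rw [hv, Matrix.mulVec_mulVec, hU', Matrix.one_mulVec]
  have hv2 : v 2 = s ⬝ᵥ p := transpose_mulVec_two hUp s
  have hvv : s ⬝ᵥ s = v 0 ^ 2 + v 1 ^ 2 + v 2 ^ 2 := by
    rw [hsv, mulVec_dotProduct_mulVec hU]
    simp [dotProduct, Fin.sum_univ_three]; ring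
  have hv0 : v ≠ 0 := by
    rintro h
    rw [h] at hsv
    simp at hsv
    exact hs hsv
  rw [hvv, ← hv2] at hsp
  have h3 : (1 : ℝ) ≤ 3 ^ k := one_le_pow₀ (by norm_num)
  have hz : v 2 ≠ 0 := by
    intro hz
    apply hs
    have hxy : v 0 ^ 2 + v 1 ^ 2 ≤ 0 := by
      rw [hz] at hsp
      nlinarith [sq_nonneg (v 0), sq_nonneg (v 1)]
    apply dotProduct_self_eq_zero.1
    rw [hvv, hz]
    nlinarith [sq_nonneg (v 0), sq_nonneg (v 1)]
  have key := hN _ _ _ hpol ⟨v 0 / v 2, v 1 / v 2⟩ (by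
    rw [Complex.normSq_apply]
    field_simp
    rw [div_le_one (by positivity)]
    linarith)
  have hvz : v 2 • (![v 0 / v 2, v 1 / v 2, 1] : Fin 3 → ℝ) = v := by
    ext i; fin_cases i <;> simp <;> field_simp
  have hch : chart (symmetrize (fun v => f (U *ᵥ v)) (W - f p)) ⟨v 0 / v 2, v 1 / v 2⟩ =
      f s + f (U *ᵥ ![-v 1, v 0, v 2]) - (W - f p) := by
    rw [chart, ← hpol.frame.smul (v 2) _ hz, hvz, symmetrize, ← hsv]
  rw [hch] at key
  have hlast : f (U *ᵥ ![-v 1, v 0, v 2]) ≤ M :=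
    hM _ (mulVec_ne_zero hU (vec_ne_zero_of_sq (by positivity)))
  have hAk : |3 * f p - W| / 2 ^ k ≤ 6 * C / 2 ^ k := by gcongr
  have hδ : (N + 1) * (M - f p) ≤ ε / 4 := by
    have : M - f p ≤ ε / (4 * (N + 1)) := by linarith
    rw [le_div_iff₀ (by positivity)] at this
    linarith
  linarith

/-- A bounded frame function attains its supremum. -/
theorem IsFrameFn.exists_max {f : (Fin 3 → ℝ) → ℝ} {W C : ℝ} (hf : IsFrameFn f W)
    (hC : ∀ v, v ≠ 0 → |f v| ≤ C) :
    ∃ p : Fin 3 → ℝ, p ⬝ᵥ p = 1 ∧ ∀ v, v ≠ 0 → f v ≤ f p := by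
  have hne0 : ∀ v : Fin 3 → ℝ, v ⬝ᵥ v = 1 → v ≠ 0 := by
    rintro v hv rfl; simp at hv
  set S : Set (Fin 3 → ℝ) := {v | v ⬝ᵥ v = 1} with hS
  have hcompact : IsCompact S := by
    apply Metric.isCompact_of_isClosed_isBounded
    · exact isClosed_eq (by fun_prop) continuous_const
    · refine (Metric.isBounded_closedBall (x := (0 : Fin 3 → ℝ)) (r := 1)).subset ?_
      intro v hv
      rw [mem_closedBall_zero_iff, pi_norm_le_iff_of_nonneg zero_le_one]
      intro i
      have : v i * v i ≤ v ⬝ᵥ v :=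
        Finset.single_le_sum (f := fun i => v i * v i) (fun i _ => mul_self_nonneg _)
          (Finset.mem_univ i)
      rw [hS, Set.mem_ofPred_eq] at hv
      rw [Real.norm_eq_abs, abs_le]
      constructor <;> nlinarith
  have hbdd : BddAbove (f '' S) :=
    ⟨C, by rintro _ ⟨v, hv, rfl⟩; exact (abs_le.1 (hC v (hne0 v hv))).2⟩
  have hnonempty : (f '' S).Nonempty := ⟨_, ![1, 0, 0], by simp [hS], rfl⟩
  set M := sSup (f '' S) with hM
  have hle : ∀ v, v ≠ 0 → f v ≤ M := by
    intro v hv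
    have hpos : 0 < v ⬝ᵥ v := by
      have : 0 ≤ v ⬝ᵥ v := Finset.sum_nonneg fun i _ => mul_self_nonneg _
      exact lt_of_le_of_ne this (fun h => hv (dotProduct_self_eq_zero.1 h.symm))
    have hs := Real.sqrt_pos.2 hpos
    have hsq := Real.mul_self_sqrt hpos.le
    rw [← hf.smul (√(v ⬝ᵥ v))⁻¹ v (by positivity)]
    refine le_csSup hbdd ⟨_, ?_, rfl⟩
    rw [hS, Set.mem_ofPred_eq, smul_dotProduct, dotProduct_smul, smul_eq_mul, smul_eq_mul]
    nth_rewrite 3 [← hsq]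
    field_simp
  have hseq : ∀ n : ℕ, ∃ p ∈ S, M - 1 / ((n : ℝ) + 1) < f p := by
    intro n
    obtain ⟨_, ⟨p, hp, rfl⟩, h⟩ := exists_lt_of_lt_csSup hnonempty
      (show M - 1 / ((n : ℝ) + 1) < M by
        have : 0 < 1 / ((n : ℝ) + 1) := by positivity
        linarith)
    exact ⟨p, hp, h⟩
  choose p hpS hp using hseq
  obtain ⟨q, hq, σ, hσ, hlim⟩ := hcompact.tendsto_subseq hpS
  refine ⟨q, hq, fun v hv => (hle v hv).trans ?_⟩
  refine le_of_forall_pos_le_add fun ε hε => ?_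
  obtain ⟨δ, K, hδ, hK, hnear⟩ := exists_near_pole C hε
  have h1 : Filter.Tendsto (fun n : ℕ => 1 / ((σ n : ℝ) + 1)) Filter.atTop (nhds 0) :=
    (tendsto_one_div_add_atTop_nhds_zero_nat (𝕜 := ℝ)).comp hσ.tendsto_atTop
  have h2 : Filter.Tendsto (fun n : ℕ => (q ⬝ᵥ q - (q ⬝ᵥ p (σ n)) ^ 2) * K -
      (q ⬝ᵥ p (σ n)) ^ 2) Filter.atTop (nhds ((q ⬝ᵥ q - (q ⬝ᵥ q) ^ 2) * K - (q ⬝ᵥ q) ^ 2)) := by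
    have hcont : Continuous fun w : Fin 3 → ℝ => (q ⬝ᵥ q - (q ⬝ᵥ w) ^ 2) * K - (q ⬝ᵥ w) ^ 2 := by
      fun_prop
    exact (hcont.tendsto q).comp hlim
  rw [show q ⬝ᵥ q = 1 from hq] at h2
  norm_num at h2
  obtain ⟨n, hn1, hn2⟩ := ((h1.eventually (gt_mem_nhds hδ)).and
    (h2.eventually (gt_mem_nhds (show (-1 : ℝ) < 0 by norm_num)))).exists
  have := hnear f W M hf hC hle (p (σ n)) (hpS _) (by linarith [hp (σ n)]) q (hne0 q hq) (by
    rw [show q ⬝ᵥ q = 1 from hq]; linarith)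
  linarith

/-- At a maximum placed on the third axis, the symmetrized frame function is quadratic. -/
theorem IsFrameFn.add_turn_eq {F : (Fin 3 → ℝ) → ℝ} {W : ℝ} (hF : IsFrameFn F W)
    (hmax : ∀ v, v ≠ 0 → F v ≤ F ![0, 0, 1]) {x y z : ℝ} (hv : 0 < x ^ 2 + y ^ 2 + z ^ 2) :
    F ![x, y, z] + F ![-y, x, z] =
      W - F ![0, 0, 1] + (3 * F ![0, 0, 1] - W) * z ^ 2 / (x ^ 2 + y ^ 2 + z ^ 2) := by
  have h := hF.isPolar_symmetrize hmax
  rw [sub_self, mul_zero] at h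
  have := h.eq_mul_sq_div hv
  simp only [symmetrize, cons_val] at this
  linarith

theorem IsFrameFn.exists_add_eq {f : (Fin 3 → ℝ) → ℝ} {W : ℝ} (hf : IsFrameFn f W)
    {p : Fin 3 → ℝ} (hp : p ⬝ᵥ p = 1) (hmax : ∀ v, v ≠ 0 → f v ≤ f p) {s : Fin 3 → ℝ}
    (hs : s ≠ 0) : ∃ s' : Fin 3 → ℝ, s' ≠ 0 ∧
      f s + f s' = W - f p + (3 * f p - W) * (s ⬝ᵥ p) ^ 2 / (s ⬝ᵥ s) := by
  obtain ⟨U, hU, hUp⟩ := exists_orthogonal_matrix_pole hp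
  have hU' : U * Uᵀ = 1 := mul_eq_one_comm.1 hU
  have hF := hf.comp_mulVec hU
  set v := Uᵀ *ᵥ s with hv
  have hsv : s = U *ᵥ v := by rw [hv, Matrix.mulVec_mulVec, hU', Matrix.one_mulVec]
  have hv2 : v 2 = s ⬝ᵥ p := transpose_mulVec_two hUp s
  have hvv : s ⬝ᵥ s = v 0 ^ 2 + v 1 ^ 2 + v 2 ^ 2 := by
    rw [hsv, mulVec_dotProduct_mulVec hU]
    simp [dotProduct, Fin.sum_univ_three]; ring
  have hpos : 0 < v 0 ^ 2 + v 1 ^ 2 + v 2 ^ 2 := by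
    rw [← hvv]
    have : 0 ≤ s ⬝ᵥ s := Finset.sum_nonneg fun i _ => mul_self_nonneg _
    exact lt_of_le_of_ne this (fun h => hs (dotProduct_self_eq_zero.1 h.symm))
  have key := hF.add_turn_eq (by
    rw [hUp]; exact fun v hv => hmax _ (mulVec_ne_zero hU hv)) hpos
  rw [hUp, ← hvv, hv2] at key
  have hvz : (![v 0, v 1, s ⬝ᵥ p] : Fin 3 → ℝ) = v := by
    ext i; fin_cases i <;> simp [hv2]
  rw [hvz, ← hsv] at key
  exact ⟨_, mulVec_ne_zero hU (vec_ne_zero_of_sq (x := -v 1) (y := v 0) (z := s ⬝ᵥ p) (by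
    rw [← hv2]; nlinarith)), key⟩

theorem exists_small_cyclic_product {a b c : ℝ} (h : a ^ 2 + b ^ 2 + c ^ 2 = 1)
    (h0 : 1 ≤ 3 * (a * b + b * c + c * a) ^ 2) (h1 : 1 ≤ 3 * (-(a * b) + b * c + c * a) ^ 2)
    (h2 : 1 ≤ 3 * (a * b - b * c + c * a) ^ 2) (h3 : 1 ≤ 3 * (a * b + b * c - c * a) ^ 2) :
    False := by
  have main : ∀ x y z : ℝ, 0 ≤ z → z ≤ y → y ≤ x → x ^ 2 + y ^ 2 + z ^ 2 = 1 →
      1 ≤ 3 * (x * y + y * z - x * z) ^ 2 → False := by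
    intro x y z hz hzy hyx hs hk
    have h1 : 0 ≤ x * y + y * z - x * z := by nlinarith [mul_nonneg hz (hz.trans hzy)]
    have h2 : x * y + y * z - x * z ≤ 1 / 2 := by nlinarith [sq_nonneg (x - y)]
    nlinarith
  have e0 := sq_abs a
  have e1 := sq_abs b
  have e2 := sq_abs c
  have hs : |a| ^ 2 + |b| ^ 2 + |c| ^ 2 = 1 := by rw [e0, e1, e2, h]
  have signs : ∀ u v w x y z : ℝ, (x = u ∨ x = -u) → (y = v ∨ y = -v) → (z = w ∨ z = -w) →
      1 ≤ 3 * (u * v + v * w + w * u) ^ 2 → 1 ≤ 3 * (-(u * v) + v * w + w * u) ^ 2 →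
      1 ≤ 3 * (u * v - v * w + w * u) ^ 2 → 1 ≤ 3 * (u * v + v * w - w * u) ^ 2 →
      1 ≤ 3 * (-(x * y) + y * z + z * x) ^ 2 ∧
      1 ≤ 3 * (x * y - y * z + z * x) ^ 2 ∧ 1 ≤ 3 * (x * y + y * z - z * x) ^ 2 := by
    rintro u v w x y z (rfl | rfl) (rfl | rfl) (rfl | rfl) h0 h1 h2 h3 <;>
    refine ⟨?_, ?_, ?_⟩ <;>
    first
    | linear_combination h0
    | linear_combination h1
    | linear_combination h2
    | linear_combination h3
  obtain ⟨k1, k2, k3⟩ := signs a b c |a| |b| |c| (abs_choice a) (abs_choice b) (abs_choice c)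
    h0 h1 h2 h3
  have ha := abs_nonneg a
  have hb := abs_nonneg b
  have hc := abs_nonneg c
  generalize |a| = x at *
  generalize |b| = y at *
  generalize |c| = z at *
  rcases le_total x y with hxy | hxy <;> rcases le_total y z with hyz | hyz <;>
    rcases le_total x z with hxz | hxz
  · exact main z y x ha hxy hyz (by linarith) (by linarith)
  · exact main z y x ha hxy hyz (by linarith) (by linarith)
  · exact main y z x ha hxz hyz (by linarith) (by linarith)
  · exact main y x z hc hxz hxy (by linarith) (by linarith)
  · exact main z x y hb hxy hxz (by linarith) (by linarith)
  · exact main x z y hb hyz hxz (by linarith) (by linarith)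
  · exact main x y z hc hyz hxy (by linarith) (by linarith)
  · exact main x y z hc hyz hxy (by linarith) (by linarith)

/-- A bounded frame function which is odd under quarter turns about two axes vanishes. -/
theorem IsFrameFn.eq_zero_of_odd {h : (Fin 3 → ℝ) → ℝ} {C : ℝ} (hf : IsFrameFn h 0)
    (hC : ∀ v, v ≠ 0 → |h v| ≤ C)
    (h1 : ∀ x y z : ℝ, 0 < x ^ 2 + y ^ 2 + z ^ 2 → h ![x, y, z] = -h ![x, -z, y])
    (h3 : ∀ x y z : ℝ, 0 < x ^ 2 + y ^ 2 + z ^ 2 → h ![x, y, z] = -h ![-y, x, z])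
    (v : Fin 3 → ℝ) (hv : v ≠ 0) : h v = 0 := by
  have hneg : ∀ x y z : ℝ, h ![-x, -y, -z] = h ![x, y, z] := by
    intro x y z
    have := hf.smul (-1) ![x, y, z] (by norm_num)
    rw [← this]
    congr 1
    ext i; fin_cases i <;> simp
  have flip12 : ∀ x y z : ℝ, 0 < x ^ 2 + y ^ 2 + z ^ 2 → h ![-x, -y, z] = h ![x, y, z] := by
    intro x y z hp
    rw [h3 x y z hp, h3 (-y) x z (by nlinarith), neg_neg]
  have flip23 : ∀ x y z : ℝ, 0 < x ^ 2 + y ^ 2 + z ^ 2 → h ![x, -y, -z] = h ![x, y, z] := by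
    intro x y z hp
    rw [h1 x y z hp, h1 x (-z) y (by nlinarith), neg_neg]
  have flip1 : ∀ x y z : ℝ, 0 < x ^ 2 + y ^ 2 + z ^ 2 → h ![-x, y, z] = h ![x, y, z] := by
    intro x y z hp
    rw [← flip23 x y z hp, ← hneg x (-y) (-z), neg_neg, neg_neg]
  have flip3 : ∀ x y z : ℝ, 0 < x ^ 2 + y ^ 2 + z ^ 2 → h ![x, y, -z] = h ![x, y, z] := by
    intro x y z hp
    rw [← flip12 x y z hp, ← hneg (-x) (-y) z, neg_neg, neg_neg]
  have flip2 : ∀ x y z : ℝ, 0 < x ^ 2 + y ^ 2 + z ^ 2 → h ![x, -y, z] = h ![x, y, z] := by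
    intro x y z hp
    rw [← flip3 x (-y) z (by nlinarith), flip23 x y z hp]
  have swap12 : ∀ x y z : ℝ, 0 < x ^ 2 + y ^ 2 + z ^ 2 → h ![y, x, z] = -h ![x, y, z] := by
    intro x y z hp
    rw [h3 x y z hp, flip1 y x z (by linarith), neg_neg]
  have swap23 : ∀ x y z : ℝ, 0 < x ^ 2 + y ^ 2 + z ^ 2 → h ![x, z, y] = -h ![x, y, z] := by
    intro x y z hp
    rw [h1 x y z hp, flip2 x z y (by linarith), neg_neg]
  have cyc : ∀ x y z : ℝ, 0 < x ^ 2 + y ^ 2 + z ^ 2 → h ![y, z, x] = h ![x, y, z] := by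
    intro x y z hp
    rw [swap23 y x z (by linarith), swap12 x y z hp, neg_neg]
  have eta : ∀ w : Fin 3 → ℝ, ![w 0, w 1, w 2] = w := by
    intro w; ext i; fin_cases i <;> rfl
  have sqpos : ∀ w : Fin 3 → ℝ, w ≠ 0 → 0 < w 0 ^ 2 + w 1 ^ 2 + w 2 ^ 2 := by
    intro w hw
    by_contra hn
    apply hw
    apply dotProduct_self_eq_zero.1
    simp only [dotProduct, Fin.sum_univ_three]
    nlinarith [sq_nonneg (w 0), sq_nonneg (w 1), sq_nonneg (w 2)]
  obtain ⟨p, hp, hmax⟩ := hf.exists_max hC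
  have hmin : ∀ w, w ≠ 0 → -h p ≤ h w := by
    intro w hw
    have hs := swap12 _ _ _ (sqpos w hw)
    rw [eta] at hs
    have := hmax ![w 1, w 0, w 2] (vec_ne_zero_of_sq (by linarith [sqpos w hw]))
    linarith
  have hpp : p 0 ^ 2 + p 1 ^ 2 + p 2 ^ 2 = 1 := by
    simp only [dotProduct, Fin.sum_univ_three] at hp
    linarith
  have hle : h p ≤ 0 := by
    by_contra! hpos
    have key : ∀ w : Fin 3 → ℝ, w ⬝ᵥ w = 1 → h w = h p → 1 ≤ 3 * (w ⬝ᵥ p) ^ 2 := by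
      intro w hw hwp
      have hw0 : w ≠ 0 := by rintro rfl; simp at hw
      obtain ⟨s, hs, hs'⟩ := hf.exists_add_eq hp hmax hw0
      have := hmin s hs
      rw [hw, hwp, div_one] at hs'
      by_contra! hlt
      nlinarith
    have hval : h ![p 1, p 2, p 0] = h p := by
      rw [cyc _ _ _ (by linarith), eta]
    apply exists_small_cyclic_product hpp
    · have := key ![p 1, p 2, p 0] (by simp; linarith) hval
      simp [dotProduct, Fin.sum_univ_three] at this
      linarith
    · have := key ![-p 1, p 2, p 0] (by simp; linarith)
        (by rw [flip1 _ _ _ (by linarith), hval])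
      simp [dotProduct, Fin.sum_univ_three] at this
      linarith
    · have := key ![p 1, -p 2, p 0] (by simp; linarith)
        (by rw [flip2 _ _ _ (by linarith), hval])
      simp [dotProduct, Fin.sum_univ_three] at this
      linarith
    · have := key ![p 1, p 2, -p 0] (by simp; linarith)
        (by rw [flip3 _ _ _ (by linarith), hval])
      simp [dotProduct, Fin.sum_univ_three] at this
      linarith
  exact le_antisymm ((hmax v hv).trans hle) (by linarith [hmin v hv])

theorem IsFrameFn.neg {f : (Fin 3 → ℝ) → ℝ} {W : ℝ} (hf : IsFrameFn f W) :
    IsFrameFn (fun v => -f v) (-W) where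
  smul t v ht := by rw [hf.smul t v ht]
  sum u v w hu hv hw huv huw hvw := by
    rw [← hf.sum u v w hu hv hw huv huw hvw]; ring

theorem IsFrameFn.exists_orthogonal_extrema {f : (Fin 3 → ℝ) → ℝ} {W C : ℝ}
    (hf : IsFrameFn f W) (hC : ∀ v, v ≠ 0 → |f v| ≤ C) :
    ∃ p r : Fin 3 → ℝ, p ⬝ᵥ p = 1 ∧ r ⬝ᵥ r = 1 ∧ p ⬝ᵥ r = 0 ∧
      (∀ v, v ≠ 0 → f v ≤ f p) ∧ ∀ v, v ≠ 0 → f r ≤ f v := by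
  obtain ⟨p, hp, hmax⟩ := hf.exists_max hC
  obtain ⟨r, hr, hmin⟩ := hf.neg.exists_max (C := C) (fun v hv => by rw [abs_neg]; exact hC v hv)
  have hmin' : ∀ v, v ≠ 0 → f r ≤ f v := fun v hv => neg_le_neg_iff.1 (hmin v hv)
  suffices h : ∃ e : Fin 3 → ℝ, e ⬝ᵥ e = 1 ∧ p ⬝ᵥ e = 0 ∧ f e ≤ f r by
    obtain ⟨e, he, hpe, hle⟩ := h
    exact ⟨p, e, hp, he, hpe, hmax, fun v hv => hle.trans (hmin' v hv)⟩
  have hp0 : p ≠ 0 := by rintro rfl; simp at hp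
  have hr0 : r ≠ 0 := by rintro rfl; simp at hr
  set c := p ⬝ᵥ r with hc
  have hrp : r ⬝ᵥ p = c := dotProduct_comm _ _
  by_cases hcol : r - c • p = 0
  · obtain ⟨e, he, hep⟩ := exists_unit_orthogonal p
    have he0 : e ≠ 0 := by rintro rfl; simp at he
    have hrc : r = c • p := sub_eq_zero.1 hcol
    have hc0 : c ≠ 0 := by
      intro h0
      rw [h0, zero_smul] at hrc
      exact hr0 hrc
    refine ⟨e, he, by rw [dotProduct_comm, hep], ?_⟩
    rw [hrc, hf.smul c p hc0]
    exact hmax e he0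
  · set e := r - c • p with he
    have hpe : p ⬝ᵥ e = 0 := by
      rw [he, dotProduct_sub, dotProduct_smul, hp, ← hc]; simp
    have hee : e ⬝ᵥ e = 1 - c ^ 2 := by
      rw [he, sub_dotProduct, dotProduct_sub, dotProduct_sub, smul_dotProduct, smul_dotProduct,
        dotProduct_smul, dotProduct_smul, hp, hr, hrp, ← hc]
      simp only [smul_eq_mul]; ring
    have hepos : 0 < e ⬝ᵥ e := by
      have : 0 ≤ e ⬝ᵥ e := Finset.sum_nonneg fun i _ => mul_self_nonneg _
      exact lt_of_le_of_ne this (fun h => hcol (dotProduct_self_eq_zero.1 h.symm))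
    have hre : r = e + c • p := by rw [he]; simp
    have hep : e ⬝ᵥ p = 0 := by rw [dotProduct_comm, hpe]
    have hn : p ⨯₃ e ≠ 0 := by
      intro h0
      have := cross_dot_cross p e p e
      rw [h0, hp, hpe] at this
      simp at this
      exact hepos.ne' (by rw [this])
    have hep' : p ⬝ᵥ (p ⨯₃ e) = 0 := dot_self_cross p e
    have hee' : e ⬝ᵥ (p ⨯₃ e) = 0 := dot_cross_self p e
    -- the pairs `p`, `e` and `r`, `(1 - c ^ 2) • p - c • e` span the same plane
    set r' := (1 - c ^ 2) • p - c • e with hr'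
    have hr'p : r' ⬝ᵥ p = 1 - c ^ 2 := by
      rw [hr', sub_dotProduct, smul_dotProduct, smul_dotProduct, hp, hep]; simp
    have hr'0 : r' ≠ 0 := by
      intro h0
      rw [h0, zero_dotProduct] at hr'p
      linarith
    have h := hf.coplanar (p ⨯₃ e) r r' p e hn hr0 hr'0 hp0 hcol
      (by
        rw [hre, hr']
        simp only [add_dotProduct, dotProduct_sub, smul_dotProduct, dotProduct_smul, hp, hep, hpe,
          hee, smul_eq_mul]
        ring)
      hpe (by rw [hre, add_dotProduct, smul_dotProduct, hep', hee']; simp)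
      (by rw [hr', sub_dotProduct, smul_dotProduct, smul_dotProduct, hep', hee']; simp) hep' hee'
    have hmr' := hmax r' hr'0
    refine ⟨(√(e ⬝ᵥ e))⁻¹ • e, ?_, ?_, ?_⟩
    · have hsq := Real.mul_self_sqrt hepos.le
      have hs := Real.sqrt_pos.2 hepos
      rw [smul_dotProduct, dotProduct_smul, smul_eq_mul, smul_eq_mul]
      nth_rewrite 3 [← hsq]
      field_simp
    · rw [dotProduct_smul, hpe]; simp
    · rw [hf.smul _ _ (by have := Real.sqrt_pos.2 hepos; positivity)]
      linarith

theorem dotProduct_self_pos {v : Fin 3 → ℝ} (hv : v ≠ 0) : 0 < v ⬝ᵥ v := by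
  have : 0 ≤ v ⬝ᵥ v := Finset.sum_nonneg fun i _ => mul_self_nonneg _
  exact lt_of_le_of_ne this (fun h => hv (dotProduct_self_eq_zero.1 h.symm))

/-- The projections onto three pairwise orthogonal lines resolve the identity. -/
theorem sum_inv_smul_vecMulVec {u v w : Fin 3 → ℝ} (hu : u ≠ 0) (hv : v ≠ 0) (hw : w ≠ 0)
    (huv : u ⬝ᵥ v = 0) (huw : u ⬝ᵥ w = 0) (hvw : v ⬝ᵥ w = 0) :
    (u ⬝ᵥ u)⁻¹ • vecMulVec u u + (v ⬝ᵥ v)⁻¹ • vecMulVec v v + (w ⬝ᵥ w)⁻¹ • vecMulVec w w =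
      (1 : Matrix (Fin 3) (Fin 3) ℝ) := by
  have hu' := (dotProduct_self_pos hu).ne'
  have hv' := (dotProduct_self_pos hv).ne'
  have hw' := (dotProduct_self_pos hw).ne'
  set A : Matrix (Fin 3) (Fin 3) ℝ := Matrix.of ![u, v, w] with hA
  set D : Matrix (Fin 3) (Fin 3) ℝ :=
    Matrix.of ![(u ⬝ᵥ u)⁻¹ • u, (v ⬝ᵥ v)⁻¹ • v, (w ⬝ᵥ w)⁻¹ • w] with hD
  have hDA : D * Aᵀ = 1 := by
    ext i j
    rw [Matrix.mul_apply']
    change ![(u ⬝ᵥ u)⁻¹ • u, (v ⬝ᵥ v)⁻¹ • v, (w ⬝ᵥ w)⁻¹ • w] i ⬝ᵥ ![u, v, w] j = _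
    fin_cases i <;> fin_cases j <;>
      simp [smul_dotProduct, huv, huw, hvw, dotProduct_comm v u, dotProduct_comm w u,
        dotProduct_comm w v, hu', hv', hw']
  rw [← mul_eq_one_comm.1 hDA]
  ext i j
  simp only [hA, hD, Matrix.mul_apply, Fin.sum_univ_three, Matrix.add_apply, Matrix.smul_apply,
    vecMulVec_apply, smul_eq_mul, Matrix.transpose_apply, Matrix.of_apply, Matrix.cons_val_zero,
    Matrix.cons_val_one, Matrix.cons_val, Pi.smul_apply]
  ring

/-- Bounded frame functions on `ℝ³` are given by quadratic forms. -/
theorem IsFrameFn.exists_matrix {f : (Fin 3 → ℝ) → ℝ} {W C : ℝ}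
    (hf : IsFrameFn f W) (hC : ∀ v, v ≠ 0 → |f v| ≤ C) :
    ∃ B : Matrix (Fin 3) (Fin 3) ℝ, ∀ v, v ≠ 0 → f v * (v ⬝ᵥ v) = v ⬝ᵥ (B *ᵥ v) := by
  obtain ⟨p, r, hp, hr, hpr, hmax, hmin⟩ := hf.exists_orthogonal_extrema hC
  obtain ⟨U, hU, hUp, hUr⟩ := exists_orthogonal_matrix hp hr hpr
  have hU' : U * Uᵀ = 1 := mul_eq_one_comm.1 hU
  set F : (Fin 3 → ℝ) → ℝ := fun v => f (U *ᵥ v) with hFdef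
  have hF : IsFrameFn F W := hf.comp_mulVec hU
  set M := f p with hM
  set m := f r with hm
  have hFM : F ![1, 0, 0] = M := by simp only [hFdef]; rw [hUp]
  have hFm : F ![0, 0, 1] = m := by simp only [hFdef]; rw [hUr]
  have hFmax : ∀ v, v ≠ 0 → F v ≤ M := fun v hv => hmax _ (mulVec_ne_zero hU hv)
  have hFmin : ∀ v, v ≠ 0 → m ≤ F v := fun v hv => hmin _ (mulVec_ne_zero hU hv)
  set q : (Fin 3 → ℝ) → ℝ := fun v =>
    (M * v 0 ^ 2 + (W - M - m) * v 1 ^ 2 + m * v 2 ^ 2) / (v ⬝ᵥ v) with hq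
  -- the turn about the third axis, at the minimum
  have hturn3 : ∀ x y z : ℝ, 0 < x ^ 2 + y ^ 2 + z ^ 2 → F ![x, y, z] + F ![-y, x, z] =
      W - m + (3 * m - W) * z ^ 2 / (x ^ 2 + y ^ 2 + z ^ 2) := by
    intro x y z h
    have := hF.neg.add_turn_eq (fun v hv => by rw [hFm]; exact neg_le_neg (hFmin v hv)) h
    rw [hFm] at this
    have e : (3 * -m - -W) * z ^ 2 / (x ^ 2 + y ^ 2 + z ^ 2) =
      -((3 * m - W) * z ^ 2 / (x ^ 2 + y ^ 2 + z ^ 2)) := by ring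
    linarith
  -- the turn about the first axis, at the maximum
  have hturn1 : ∀ x y z : ℝ, 0 < x ^ 2 + y ^ 2 + z ^ 2 → F ![x, y, z] + F ![x, -z, y] =
      W - M + (3 * M - W) * x ^ 2 / (x ^ 2 + y ^ 2 + z ^ 2) := by
    intro x y z h
    set V : Matrix (Fin 3) (Fin 3) ℝ := !![0, 0, 1; 1, 0, 0; 0, 1, 0] with hVdef
    have hV : Vᵀ * V = 1 := by
      ext i j; fin_cases i <;> fin_cases j <;> simp [hVdef, Matrix.mul_apply, Fin.sum_univ_three]
    have hVv : ∀ a b c : ℝ, V *ᵥ ![a, b, c] = ![c, a, b] := by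
      intro a b c
      ext i; fin_cases i <;> simp [hVdef, Matrix.mulVec, dotProduct, Fin.sum_univ_three]
    have := (hF.comp_mulVec hV).add_turn_eq (x := y) (y := z) (z := x) (fun v hv => by
      rw [hVv, hFM]; exact hFmax _ (mulVec_ne_zero hV hv)) (by linarith)
    rw [hVv, hVv, hVv, hFM] at this
    rw [this, show y ^ 2 + z ^ 2 + x ^ 2 = x ^ 2 + y ^ 2 + z ^ 2 by ring]
  have hqv : ∀ x y z : ℝ, q ![x, y, z] =
      (M * x ^ 2 + (W - M - m) * y ^ 2 + m * z ^ 2) / (x ^ 2 + y ^ 2 + z ^ 2) := by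
    intro x y z
    simp only [hq]
    congr 1
    simp; ring
  have hself : ∀ v : Fin 3 → ℝ, v ≠ 0 → 0 < v ⬝ᵥ v := fun v => dotProduct_self_pos
  have hqframe : IsFrameFn q W := by
    constructor
    · intro t v ht
      simp only [hq, dotProduct, Fin.sum_univ_three, Pi.smul_apply, smul_eq_mul]
      rw [show t * v 0 * (t * v 0) + t * v 1 * (t * v 1) + t * v 2 * (t * v 2) =
        t ^ 2 * (v 0 * v 0 + v 1 * v 1 + v 2 * v 2) by ring,
        show M * (t * v 0) ^ 2 + (W - M - m) * (t * v 1) ^ 2 + m * (t * v 2) ^ 2 =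
        t ^ 2 * (M * v 0 ^ 2 + (W - M - m) * v 1 ^ 2 + m * v 2 ^ 2) by ring]
      exact mul_div_mul_left _ _ (pow_ne_zero 2 ht)
    · intro u v w hu hv hw huv huw hvw
      have hcol : ∀ i, u i ^ 2 / (u ⬝ᵥ u) + v i ^ 2 / (v ⬝ᵥ v) + w i ^ 2 / (w ⬝ᵥ w) = 1 := by
        intro i
        have := congrFun (congrFun (sum_inv_smul_vecMulVec hu hv hw huv huw hvw) i) i
        simp only [Matrix.add_apply, Matrix.smul_apply, vecMulVec_apply, smul_eq_mul,
          Matrix.one_apply_eq] at this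
        rw [← this]
        ring
      have c0 := hcol 0
      have c1 := hcol 1
      have c2 := hcol 2
      simp only [hq]
      linear_combination M * c0 + (W - M - m) * c1 + m * c2
  have hdframe : IsFrameFn (fun v => F v - q v) 0 := by
    constructor
    · intro t v ht
      rw [hF.smul t v ht, hqframe.smul t v ht]
    · intro u v w hu hv hw huv huw hvw
      linear_combination hF.sum u v w hu hv hw huv huw hvw -
        hqframe.sum u v w hu hv hw huv huw hvw
  have hdbound : ∀ v, v ≠ 0 → |F v - q v| ≤ C + (|M| + |W - M - m| + |m|) := by
    intro v hv
    refine (abs_sub _ _).trans (add_le_add (hC _ (mulVec_ne_zero hU hv)) ?_)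
    have h := hself v hv
    simp only [hq]
    rw [abs_div, abs_of_pos h, div_le_iff₀ h]
    have e : v ⬝ᵥ v = v 0 ^ 2 + v 1 ^ 2 + v 2 ^ 2 := by
      simp [dotProduct, Fin.sum_univ_three]; ring
    rw [e]
    calc _ ≤ |M * v 0 ^ 2| + |(W - M - m) * v 1 ^ 2| + |m * v 2 ^ 2| := abs_add_three _ _ _
      _ = |M| * v 0 ^ 2 + |W - M - m| * v 1 ^ 2 + |m| * v 2 ^ 2 := by simp [abs_mul]
      _ ≤ _ := by
        have := abs_nonneg M
        have := abs_nonneg (W - M - m)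
        have := abs_nonneg m
        nlinarith [mul_nonneg (abs_nonneg M) (sq_nonneg (v 1)),
          mul_nonneg (abs_nonneg M) (sq_nonneg (v 2)),
          mul_nonneg (abs_nonneg (W - M - m)) (sq_nonneg (v 0)),
          mul_nonneg (abs_nonneg (W - M - m)) (sq_nonneg (v 2)),
          mul_nonneg (abs_nonneg m) (sq_nonneg (v 0)),
          mul_nonneg (abs_nonneg m) (sq_nonneg (v 1))]
  have hzero := hdframe.eq_zero_of_odd hdbound
    (fun x y z h => by
      have := hturn1 x y z h
      rw [hqv, hqv, show x ^ 2 + (-z) ^ 2 + y ^ 2 = x ^ 2 + y ^ 2 + z ^ 2 by ring]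
      have e : (M * x ^ 2 + (W - M - m) * y ^ 2 + m * z ^ 2) / (x ^ 2 + y ^ 2 + z ^ 2) +
        (M * x ^ 2 + (W - M - m) * (-z) ^ 2 + m * y ^ 2) / (x ^ 2 + y ^ 2 + z ^ 2) =
        W - M + (3 * M - W) * x ^ 2 / (x ^ 2 + y ^ 2 + z ^ 2) := by field_simp; ring
      linarith)
    (fun x y z h => by
      have := hturn3 x y z h
      rw [hqv, hqv, show (-y) ^ 2 + x ^ 2 + z ^ 2 = x ^ 2 + y ^ 2 + z ^ 2 by ring]
      have e : (M * x ^ 2 + (W - M - m) * y ^ 2 + m * z ^ 2) / (x ^ 2 + y ^ 2 + z ^ 2) +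
        (M * (-y) ^ 2 + (W - M - m) * x ^ 2 + m * z ^ 2) / (x ^ 2 + y ^ 2 + z ^ 2) =
        W - m + (3 * m - W) * z ^ 2 / (x ^ 2 + y ^ 2 + z ^ 2) := by field_simp; ring
      linarith)
  refine ⟨U * Matrix.diagonal ![M, W - M - m, m] * Uᵀ, fun s hs => ?_⟩
  set v := Uᵀ *ᵥ s with hv
  have hsv : s = U *ᵥ v := by rw [hv, Matrix.mulVec_mulVec, hU', Matrix.one_mulVec]
  have hv0 : v ≠ 0 := by
    rintro h
    rw [h] at hsv
    simp at hsv
    exact hs hsv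
  have h1 : f s = q v := by
    have := hzero v hv0
    simp only [hFdef, ← hsv] at this
    linarith
  have h2 : s ⬝ᵥ s = v ⬝ᵥ v := by rw [hsv, mulVec_dotProduct_mulVec hU]
  have h3 : s ⬝ᵥ ((U * Matrix.diagonal ![M, W - M - m, m] * Uᵀ) *ᵥ s) =
      v ⬝ᵥ (Matrix.diagonal ![M, W - M - m, m] *ᵥ v) := by
    rw [← Matrix.mulVec_mulVec, ← Matrix.mulVec_mulVec, ← hv]
    conv_lhs => rw [hsv]
    rw [mulVec_dotProduct_mulVec hU]
  have h4 := hself v hv0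
  rw [h1, h2, h3]
  simp only [hq]
  rw [div_mul_cancel₀ _ h4.ne']
  simp [dotProduct, Fin.sum_univ_three, Matrix.mulVec_diagonal]
  ring

section Polarization

/-- The polarization of a function on an additive group. -/
def polarize {V : Type*} [AddCommGroup V] (F : V → ℝ) (x y : V) : ℝ := F (x + y) - F x - F y

theorem polarize_comm {V : Type*} [AddCommGroup V] (F : V → ℝ) (x y : V) :
    polarize F x y = polarize F y x := by
  rw [polarize, polarize, add_comm]; ring

variable {V : Type*} [NormedAddCommGroup V] [InnerProductSpace ℂ V]

/-- A function on a complex inner product space that scales like a squared norm and restricts to a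
real quadratic form on the real span of every orthogonal triple. -/
structure IsLocallyQuadratic (F : V → ℝ) : Prop where
  smul : ∀ (c : ℂ) (v : V), F (c • v) = ‖c‖ ^ 2 * F v
  quad : ∀ x y z : V, inner ℂ x y = 0 → inner ℂ x z = 0 → inner ℂ y z = 0 →
    ∃ A B C D E G : ℝ, ∀ s t r : ℝ, F ((s : ℂ) • x + (t : ℂ) • y + (r : ℂ) • z) =
      A * s ^ 2 + B * t ^ 2 + C * r ^ 2 + D * (s * t) + E * (s * r) + G * (t * r)

namespace IsLocallyQuadratic

variable {F : V → ℝ}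

theorem map_zero (hF : IsLocallyQuadratic F) : F 0 = 0 := by simpa using hF.smul 0 0

theorem polarize_zero_left (hF : IsLocallyQuadratic F) (y : V) : polarize F 0 y = 0 := by
  simp [polarize, hF.map_zero]

theorem polarize_zero_right (hF : IsLocallyQuadratic F) (x : V) : polarize F x 0 = 0 := by
  simp [polarize, hF.map_zero]

theorem polarize_smul_smul (hF : IsLocallyQuadratic F) (c : ℂ) (x y : V) :
    polarize F (c • x) (c • y) = ‖c‖ ^ 2 * polarize F x y := by
  simp only [polarize, ← smul_add, hF.smul]; ring

theorem polarize_add (hF : IsLocallyQuadratic F) {x y z : V}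
    (hxy : inner ℂ x y = 0) (hxz : inner ℂ x z = 0)
    (hyz : inner ℂ y z = 0) : polarize F x (y + z) = polarize F x y + polarize F x z := by
  obtain ⟨A, B, C, D, E, G, h⟩ := hF.quad x y z hxy hxz hyz
  have h1 := h 1 1 1
  have h2 := h 1 1 0
  have h3 := h 1 0 1
  have h4 := h 0 1 1
  have h5 := h 1 0 0
  have h6 := h 0 1 0
  have h7 := h 0 0 1
  simp only [Complex.ofReal_one, Complex.ofReal_zero, one_smul, zero_smul, add_zero, zero_add]
    at h1 h2 h3 h4 h5 h6 h7
  rw [polarize, polarize, polarize, ← add_assoc]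
  linarith

theorem polarize_ofReal_smul (hF : IsLocallyQuadratic F) {x y : V} (hxy : inner ℂ x y = 0) (t : ℝ) :
    polarize F x ((t : ℂ) • y) = t * polarize F x y := by
  obtain ⟨A, B, C, D, E, G, h⟩ := hF.quad x y 0 hxy (by simp) (by simp)
  have h1 := h 1 1 0
  have h2 := h 1 t 0
  have h3 := h 1 0 0
  have h4 := h 0 1 0
  have h5 := h 0 t 0
  simp only [Complex.ofReal_one, Complex.ofReal_zero, one_smul, zero_smul, add_zero, zero_add]
    at h1 h2 h3 h4 h5
  rw [polarize, polarize, h1, h2, h3, h4, h5]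
  ring

theorem polarize_neg (hF : IsLocallyQuadratic F) {x y : V} (hxy : inner ℂ x y = 0) :
    polarize F x (-y) = -polarize F x y := by
  simpa using hF.polarize_ofReal_smul hxy (-1)

/-- Orthogonal additivity in a second direction `z` forces additivity along the complex line of
`w`, the additivity defects along `w` and `z` being opposite and odd in `z`. -/
theorem polarize_add_smul (hF : IsLocallyQuadratic F) {x w z : V}
    (hxw : inner ℂ x w = 0) (hxz : inner ℂ x z = 0)
    (hwz : inner ℂ w z = 0) (hw : ‖w‖ = 1) (hz : ‖z‖ = 1) (a b : ℂ) :
    polarize F x ((a + b) • w) = polarize F x (a • w) + polarize F x (b • w) := by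
  have hzw : inner ℂ z w = 0 := by rw [← inner_conj_symm, hwz]; simp
  have key : ∀ z : V, inner ℂ x z = 0 → inner ℂ w z = 0 → inner ℂ z w = 0 →
      ‖z‖ = 1 →
      polarize F x ((a + b) • w) + polarize F x ((1 - star a * b) • z) =
        polarize F x (a • w) + polarize F x z +
          (polarize F x (b • w) + polarize F x ((-(star a * b)) • z)) := by
    intro z hxz hwz hzw hz
    have h := hF.polarize_add (x := x) (y := a • w + z) (z := b • w + (-(star a * b)) • z)
      (by simp [hxw, hxz]) (by simp [hxw, hxz])
      (by simp [inner_add_left, inner_smul_right, inner_smul_left, hwz, hzw, hw, hz, mul_comm])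
    have split : ∀ c d : ℂ, polarize F x (c • w + d • z) =
        polarize F x (c • w) + polarize F x (d • z) := fun c d =>
      hF.polarize_add (by simp [hxw]) (by simp [hxz]) (by simp [hwz])
    have e : a • w + z + (b • w + (-(star a * b)) • z) =
        (a + b) • w + (1 - star a * b) • z := by module
    have h1 := split a 1
    rw [one_smul] at h1
    rw [e, split, split, h1] at h
    exact h
  have h1 := key z hxz hwz hzw hz
  have h2 := key (-z) (by simp [hxz]) (by simp [hwz]) (by simp [hzw]) (by simp [hz])
  have odd : ∀ c : ℂ, polarize F x (c • -z) = -polarize F x (c • z) := fun c => by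
    rw [smul_neg]
    exact hF.polarize_neg (by simp [hxz])
  rw [odd, odd, hF.polarize_neg hxz] at h2
  linarith

theorem polarize_smul_eq_re (hF : IsLocallyQuadratic F) {x w z : V}
    (hxw : inner ℂ x w = 0) (hxz : inner ℂ x z = 0)
    (hwz : inner ℂ w z = 0) (hw : ‖w‖ = 1) (hz : ‖z‖ = 1) (c d : ℂ) :
    polarize F (c • x) (d • w) = (star c * d *
      (polarize F x w - polarize F x (Complex.I • w) * Complex.I)).re := by
  have hlin : ∀ ζ : ℂ, polarize F x (ζ • w) =
      (ζ * (polarize F x w - polarize F x (Complex.I • w) * Complex.I)).re := by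
    intro ζ
    conv_lhs => rw [← Complex.re_add_im ζ]
    rw [hF.polarize_add_smul hxw hxz hwz hw hz, hF.polarize_ofReal_smul hxw, mul_smul,
      hF.polarize_ofReal_smul (by simp [hxw])]
    simp
  rcases eq_or_ne c 0 with rfl | hc
  · simp [hF.polarize_zero_left]
  · have e : d • w = c • ((c⁻¹ * d) • w) := by
      rw [smul_smul, mul_inv_cancel_left₀ hc]
    rw [e, hF.polarize_smul_smul, hlin, ← Complex.re_ofReal_mul]
    congr 1
    have : ((‖c‖ ^ 2 : ℝ) : ℂ) = star c * c := by
      rw [← Complex.normSq_eq_norm_sq, Complex.star_def, Complex.normSq_eq_conj_mul_self]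
    rw [this]
    field_simp

theorem polarize_sum (hF : IsLocallyQuadratic F) {ι : Type*} (s : Finset ι) (x : V) (v : ι → V)
    (hx : ∀ i ∈ s, inner ℂ x (v i) = 0)
    (hv : ∀ i ∈ s, ∀ j ∈ s, i ≠ j → inner ℂ (v i) (v j) = 0) :
    polarize F x (∑ i ∈ s, v i) = ∑ i ∈ s, polarize F x (v i) := by
  classical
  induction s using Finset.induction_on with
  | empty => simp [hF.polarize_zero_right]
  | insert a s ha ih =>
    rw [Finset.sum_insert ha, Finset.sum_insert ha, hF.polarize_add, ih]
    · exact fun i hi => hx i (Finset.mem_insert_of_mem hi)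
    · exact fun i hi j hj =>
        hv i (Finset.mem_insert_of_mem hi) j (Finset.mem_insert_of_mem hj)
    · exact hx a (Finset.mem_insert_self a s)
    · rw [inner_sum]
      exact Finset.sum_eq_zero fun i hi => hx i (Finset.mem_insert_of_mem hi)
    · rw [inner_sum]
      exact Finset.sum_eq_zero fun i hi => hv a (Finset.mem_insert_self a s) i
        (Finset.mem_insert_of_mem hi) (ne_of_mem_of_not_mem hi ha).symm

/-- A locally quadratic function is the real part of a sesquilinear form in the coordinates of an
orthonormal family with at least three members. -/
theorem exists_matrix (hF : IsLocallyQuadratic F) {ι : Type*} [Fintype ι]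
    (hι : 3 ≤ Fintype.card ι) {e : ι → V}
    (he : Orthonormal ℂ e) :
    ∃ H : ι → ι → ℂ, ∀ c : ι → ℂ,
      F (∑ i, c i • e i) = ∑ i, ∑ j, (star (c i) * c j * H i j).re := by
  classical
  have third : ∀ i j : ι, ∃ k, k ≠ i ∧ k ≠ j := by
    intro i j
    have hlt : ({i, j} : Finset ι).card < Fintype.card ι :=
      (Finset.card_le_two).trans_lt (by omega)
    obtain ⟨k, hk⟩ := Finset.exists_mem_notMem_of_card_lt_card
      (s := {i, j}) (t := Finset.univ) (by simpa using hlt)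
    refine ⟨k, ?_⟩
    simpa using hk
  have orth : ∀ i j, i ≠ j → inner ℂ (e i) (e j) = 0 := fun i j hij => he.2 hij
  let h : ι → ι → ℂ := fun i j =>
    polarize F (e i) (e j) - polarize F (e i) (Complex.I • e j) * Complex.I
  have hpol : ∀ (c : ι → ℂ) i j, i ≠ j → polarize F (c i • e i) (c j • e j) =
      (star (c i) * c j * h i j).re := by
    intro c i j hij
    obtain ⟨k, hki, hkj⟩ := third i j
    exact hF.polarize_smul_eq_re (orth i j hij) (orth i k hki.symm) (orth j k hkj.symm)
      (he.1 j) (he.1 k) (c i) (c j)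
  refine ⟨fun i j => if i = j then (F (e i) : ℂ) else h i j / 2, fun c => ?_⟩
  have main : ∀ s : Finset ι, F (∑ i ∈ s, c i • e i) = ∑ i ∈ s, ∑ j ∈ s,
      (star (c i) * c j * (if i = j then (F (e i) : ℂ) else h i j / 2)).re := by
    intro s
    have half : ∀ i j, i ≠ j →
        (star (c i) * c j * (if i = j then (F (e i) : ℂ) else h i j / 2)).re =
          polarize F (c i • e i) (c j • e j) / 2 := by
      intro i j hij
      rw [if_neg hij, hpol c i j hij, ← mul_div_assoc]
      simp
    have diag : ∀ i, (star (c i) * c i * (if True then (F (e i) : ℂ) else h i i / 2)).re =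
        F (c i • e i) := by
      intro i
      rw [if_pos trivial, hF.smul, ← Complex.normSq_eq_norm_sq, Complex.star_def,
        ← Complex.normSq_eq_conj_mul_self, Complex.re_ofReal_mul, Complex.ofReal_re]
    induction s using Finset.induction_on with
    | empty => simp [hF.map_zero]
    | insert a s ha ih =>
      have hne : ∀ i ∈ s, i ≠ a := fun i hi => ne_of_mem_of_not_mem hi ha
      have hp := hF.polarize_sum s (c a • e a) (fun i => c i • e i)
        (fun i hi => by simp [orth a i (hne i hi).symm])
        (fun i _ j _ hij => by simp [orth i j hij])
      have e1 : ∑ i ∈ s, (star (c i) * c a *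
          (if i = a then (F (e i) : ℂ) else h i a / 2)).re =
          (∑ i ∈ s, polarize F (c a • e a) (c i • e i)) / 2 := by
        rw [Finset.sum_div]
        exact Finset.sum_congr rfl fun i hi => by rw [half i a (hne i hi), polarize_comm]
      have e2 : ∑ i ∈ s, (star (c a) * c i *
          (if a = i then (F (e a) : ℂ) else h a i / 2)).re =
          (∑ i ∈ s, polarize F (c a • e a) (c i • e i)) / 2 := by
        rw [Finset.sum_div]
        exact Finset.sum_congr rfl fun i hi => half a i (hne i hi).symm
      rw [Finset.sum_insert ha, Finset.sum_insert ha, Finset.sum_insert ha]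
      simp_rw [Finset.sum_insert ha]
      rw [Finset.sum_add_distrib, ← ih, e1, e2, diag, ← hp, polarize]
      ring
  exact main Finset.univ

end IsLocallyQuadratic

end Polarization

/-- The orthogonal projection onto the line spanned by `v`. -/
noncomputable def lineProj {m : ℕ} (v : Fin m → ℂ) : Matrix (Fin m) (Fin m) ℂ :=
  (star v ⬝ᵥ v)⁻¹ • vecMulVec v (star v)

theorem isStarProjection_lineProj {m : ℕ} (v : Fin m → ℂ) : IsStarProjection (lineProj v) := by
  constructor
  · rcases eq_or_ne v 0 with rfl | hv
    · simp [lineProj, IsIdempotentElem]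
    · have h : star v ⬝ᵥ v ≠ 0 := fun h => hv (dotProduct_star_self_eq_zero.1 h)
      rw [IsIdempotentElem, lineProj, smul_mul_smul_comm, vecMulVec_mul_vecMulVec, vecMulVec_smul,
        smul_smul, mul_assoc, inv_mul_cancel₀ h, mul_one]
  · rw [IsSelfAdjoint, star_eq_conjTranspose, lineProj, conjTranspose_smul, conjTranspose_vecMulVec,
      star_star, star_inv₀, ← star_dotProduct]

theorem lineProj_mul_lineProj {m : ℕ} {v w : Fin m → ℂ} (h : star v ⬝ᵥ w = 0) :
    lineProj v * lineProj w = 0 := by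
  rw [lineProj, lineProj, smul_mul_smul_comm, vecMulVec_mul_vecMulVec, h]
  simp

theorem lineProj_smul {m : ℕ} {c : ℂ} (hc : c ≠ 0) (v : Fin m → ℂ) :
    lineProj (c • v) = lineProj v := by
  have hc' : star c ≠ 0 := star_ne_zero.2 hc
  simp only [lineProj, star_smul, smul_dotProduct, dotProduct_smul, smul_vecMulVec, vecMulVec_smul,
    smul_smul, smul_eq_mul]
  congr 1
  field_simp

theorem lineProj_mulVec {n m : ℕ} {E : Matrix (Fin n) (Fin m) ℂ} (hE : Eᴴ * E = 1)
    (v : Fin m → ℂ) : lineProj (E *ᵥ v) = E * lineProj v * Eᴴ := by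
  rw [lineProj, lineProj, star_mulVec, ← dotProduct_mulVec, mulVec_mulVec, hE, one_mulVec,
    Matrix.mul_smul, Matrix.smul_mul, mul_vecMulVec, vecMulVec_mul]

theorem lineProj_ofReal (u : Fin 3 → ℝ) :
    lineProj (fun i => (u i : ℂ)) = ((u ⬝ᵥ u)⁻¹ • vecMulVec u u).map Complex.ofReal := by
  ext i j
  simp [lineProj, vecMulVec_apply, dotProduct]

/-- A nonnegative function on projections, bounded by one and additive on orthogonal pairs. -/
structure IsProjectionMeasure {n : ℕ} (f : Matrix (Fin n) (Fin n) ℂ → ℝ) : Prop where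
  nonneg : ∀ P, IsStarProjection P → 0 ≤ f P
  le_one : ∀ P, IsStarProjection P → f P ≤ 1
  add : ∀ P Q, IsStarProjection P → IsStarProjection Q → P * Q = 0 → f (P + Q) = f P + f Q

namespace IsProjectionMeasure

variable {n : ℕ} {f : Matrix (Fin n) (Fin n) ℂ → ℝ}

theorem map_zero (hf : IsProjectionMeasure f) : f 0 = 0 := by
  simpa using hf.add 0 0 (.zero _) (.zero _) (by simp)

theorem sum_lineProj (hf : IsProjectionMeasure f) {ι : Type*} (s : Finset ι) (v : ι → Fin n → ℂ)
    (hv : ∀ i j, i ≠ j → star (v i) ⬝ᵥ v j = 0) :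
    IsStarProjection (∑ i ∈ s, lineProj (v i)) ∧
      f (∑ i ∈ s, lineProj (v i)) = ∑ i ∈ s, f (lineProj (v i)) := by
  classical
  induction s using Finset.induction_on with
  | empty => exact ⟨by simp, by simpa using hf.map_zero⟩
  | insert a s ha ih =>
    have h0 : lineProj (v a) * ∑ i ∈ s, lineProj (v i) = 0 := by
      rw [Finset.mul_sum]
      exact Finset.sum_eq_zero fun i hi =>
        lineProj_mul_lineProj (hv a i (ne_of_mem_of_not_mem hi ha).symm)
    rw [Finset.sum_insert ha, Finset.sum_insert ha]
    exact ⟨(isStarProjection_lineProj _).add ih.1 h0,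
      by rw [hf.add _ _ (isStarProjection_lineProj _) ih.1 h0, ih.2]⟩

/-- An isometric copy of real three-space turns a projection measure into a frame function. -/
theorem isFrameFn (hf : IsProjectionMeasure f) {E : Matrix (Fin n) (Fin 3) ℂ} (hE : Eᴴ * E = 1) :
    IsFrameFn (fun u => f (lineProj (E *ᵥ fun i => (u i : ℂ)))) (f (E * Eᴴ)) := by
  constructor
  · intro t v ht
    have : (E *ᵥ fun i => (((t • v) i : ℝ) : ℂ)) = (t : ℂ) • (E *ᵥ fun i => (v i : ℂ)) := by
      rw [← mulVec_smul]
      congr 1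
      ext i
      simp
    simp only [this]
    rw [lineProj_smul (by exact_mod_cast ht)]
  · intro u v w hu hv hw huv huw hvw
    have horth : ∀ x y : Fin 3 → ℝ, x ⬝ᵥ y = 0 →
        star (E *ᵥ fun i => (x i : ℂ)) ⬝ᵥ (E *ᵥ fun i => (y i : ℂ)) = 0 := by
      intro x y hxy
      rw [star_mulVec, ← dotProduct_mulVec, mulVec_mulVec, hE, one_mulVec]
      have : ((x ⬝ᵥ y : ℝ) : ℂ) = 0 := by rw [hxy]; simp
      rw [← this]
      simp [dotProduct]
    have hsum := (hf.sum_lineProj Finset.univ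
      (fun k : Fin 3 => E *ᵥ fun i => ((![u, v, w] k i : ℝ) : ℂ)) (by
        intro i j hij
        apply horth
        fin_cases i <;> fin_cases j <;>
          simp_all [dotProduct_comm v u, dotProduct_comm w u, dotProduct_comm w v])).2
    simp only [Fin.sum_univ_three, Matrix.cons_val_zero, Matrix.cons_val_one,
      Matrix.cons_val] at hsum
    rw [← hsum]
    congr 1
    simp only [lineProj_mulVec hE, lineProj_ofReal]
    rw [← Matrix.add_mul, ← Matrix.add_mul, ← Matrix.mul_add, ← Matrix.mul_add]
    have := congrArg (fun M => M.map Complex.ofReal)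
      (sum_inv_smul_vecMulVec hu hv hw huv huw hvw)
    simp only [Matrix.map_add _ Complex.ofReal_add] at this
    rw [this, Matrix.map_one _ Complex.ofReal_zero Complex.ofReal_one, Matrix.mul_one]

end IsProjectionMeasure

/-- Three pairwise orthogonal vectors are multiples of the members of an orthonormal triple. -/
theorem exists_orthonormal_triple {V : Type*} [NormedAddCommGroup V] [InnerProductSpace ℂ V]
    [FiniteDimensional ℂ V] (hV : 3 ≤ Module.finrank ℂ V) (x : Fin 3 → V)
    (hx : ∀ i j, i ≠ j → inner ℂ (x i) (x j) = 0) :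
    ∃ e : Fin 3 → V, Orthonormal ℂ e ∧ ∀ i, x i = (‖x i‖ : ℂ) • e i := by
  let v : Fin (Module.finrank ℂ V) → V := fun k =>
    if h : (k : ℕ) < 3 then ((‖x ⟨k, h⟩‖ : ℂ)⁻¹) • x ⟨k, h⟩ else 0
  have hv : ∀ i : Fin 3, v (Fin.castLE hV i) = ((‖x i‖ : ℂ)⁻¹) • x i := by
    intro i
    simp [v]
  let s : Set (Fin (Module.finrank ℂ V)) := Fin.castLE hV '' {i | x i ≠ 0}
  obtain ⟨b, hb⟩ := Orthonormal.exists_orthonormalBasis_extension_of_card_eq (𝕜 := ℂ) (v := v)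
    (s := s) (by simp) (by
      constructor
      · rintro ⟨_, i, hi, rfl⟩
        have : ‖x i‖ ≠ 0 := norm_ne_zero_iff.2 hi
        simp [hv, norm_smul, this]
      · rintro ⟨_, i, hi, rfl⟩ ⟨_, j, hj, rfl⟩ hij
        have : i ≠ j := by rintro rfl; exact hij rfl
        simp [hv, inner_smul_left, inner_smul_right, hx i j this])
  refine ⟨fun i => b (Fin.castLE hV i), b.orthonormal.comp _ (Fin.castLE_injective hV),
    fun i => ?_⟩
  rcases eq_or_ne (x i) 0 with h | h
  · simp [h]
  · have : (‖x i‖ : ℂ) ≠ 0 := by simpa using h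
    simp only
    rw [hb _ ⟨i, h, rfl⟩, hv, smul_smul, mul_inv_cancel₀ this, one_smul]

theorem trace_mul_lineProj {n : ℕ} (A : Matrix (Fin n) (Fin n) ℂ) (v : Fin n → ℂ) :
    (A * lineProj v).trace = (star v ⬝ᵥ v)⁻¹ * (star v ⬝ᵥ (A *ᵥ v)) := by
  rw [lineProj, Matrix.mul_smul, trace_smul, mul_vecMulVec, trace_vecMulVec, smul_eq_mul,
    dotProduct_comm (A *ᵥ v)]

/-- A projection is the sum of the projections onto the lines of an orthonormal basis of its
range. -/
theorem exists_eq_sum_lineProj {n : ℕ} {P : Matrix (Fin n) (Fin n) ℂ} (hP : IsStarProjection P) :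
    ∃ (s : Finset (Fin n)) (v : Fin n → Fin n → ℂ), (∀ i j, i ≠ j → star (v i) ⬝ᵥ v j = 0) ∧
      (∀ i, star (v i) ⬝ᵥ v i = 1) ∧ P = ∑ i ∈ s, lineProj (v i) := by
  classical
  have hH : P.IsHermitian := hP.isSelfAdjoint
  let v : Fin n → Fin n → ℂ := fun i => hH.eigenvectorBasis i
  have horth : ∀ i j, star (v i) ⬝ᵥ v j = if i = j then 1 else 0 := by
    intro i j
    rw [← orthonormal_iff_ite.1 hH.eigenvectorBasis.orthonormal i j,
      EuclideanSpace.inner_eq_star_dotProduct, dotProduct_comm]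
  have hev : ∀ i, hH.eigenvalues i = 0 ∨ hH.eigenvalues i = 1 := by
    intro i
    have h1 := hH.mulVec_eigenvectorBasis i
    have h2 : P *ᵥ (P *ᵥ v i) = P *ᵥ v i := by
      rw [mulVec_mulVec, hP.isIdempotentElem.eq]
    have h3 : P *ᵥ v i = hH.eigenvalues i • v i := h1
    rw [h3, mulVec_smul, h3] at h2
    have h4 := congrArg (fun w => star (v i) ⬝ᵥ w) h2
    simp only [dotProduct_smul, horth, if_true] at h4
    have h5 : hH.eigenvalues i * hH.eigenvalues i = hH.eigenvalues i := by
      have := congrArg Complex.re h4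
      simpa using this
    rcases eq_or_ne (hH.eigenvalues i) 0 with h | h
    · exact Or.inl h
    · exact Or.inr (mul_left_cancel₀ h (by rw [h5, mul_one]))
  refine ⟨Finset.univ.filter fun i => hH.eigenvalues i = 1, v,
    fun i j hij => by rw [horth, if_neg hij], fun i => by rw [horth, if_pos rfl], ?_⟩
  have hspec := hH.spectral_theorem
  rw [Unitary.conjStarAlgAut_apply] at hspec
  ext a b
  conv_lhs => rw [hspec]
  rw [Finset.sum_filter, Matrix.sum_apply, Matrix.mul_apply]
  refine Finset.sum_congr rfl fun i _ => ?_
  rw [Matrix.mul_diagonal, star_eq_conjTranspose, conjTranspose_apply]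
  have hl : lineProj (v i) a b = v i a * star (v i b) := by
    rw [lineProj, horth, if_pos rfl, inv_one, one_smul, vecMulVec_apply, Pi.star_apply]
  rcases hev i with h | h
  · simp [h]
  · simp [h, hl, v]

namespace IsProjectionMeasure

variable {n : ℕ} {f : Matrix (Fin n) (Fin n) ℂ → ℝ}

theorem isLocallyQuadratic (hf : IsProjectionMeasure f) (hn : 3 ≤ n) :
    IsLocallyQuadratic (fun v : EuclideanSpace ℂ (Fin n) => ‖v‖ ^ 2 * f (lineProj v.ofLp)) := by
  constructor
  · intro c v
    rcases eq_or_ne c 0 with rfl | hc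
    · simp
    · simp only [WithLp.ofLp_smul, lineProj_smul hc, norm_smul]
      ring
  · intro x y z hxy hxz hyz
    have hyx := inner_eq_zero_symm.1 hxy
    have hzx := inner_eq_zero_symm.1 hxz
    have hzy := inner_eq_zero_symm.1 hyz
    obtain ⟨e, he, hxe⟩ := exists_orthonormal_triple (by simpa using hn) ![x, y, z] (by
      intro i j hij
      fin_cases i <;> fin_cases j <;> simp_all)
    let E : Matrix (Fin n) (Fin 3) ℂ := Matrix.of fun a i => e i a
    have hE : Eᴴ * E = 1 := by
      ext i j
      rw [Matrix.one_apply, ← orthonormal_iff_ite.1 he i j,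
        EuclideanSpace.inner_eq_star_dotProduct, Matrix.mul_apply, dotProduct]
      exact Finset.sum_congr rfl fun a _ => mul_comm _ _
    obtain ⟨B, hB⟩ := (hf.isFrameFn hE).exists_matrix (C := 1) fun v _ => by
      rw [abs_of_nonneg (hf.nonneg _ (isStarProjection_lineProj _))]
      exact hf.le_one _ (isStarProjection_lineProj _)
    have hx := hxe 0
    have hy := hxe 1
    have hz := hxe 2
    simp only [Matrix.cons_val_zero, Matrix.cons_val_one, Matrix.cons_val] at hx hy hz
    have key : ∀ u : Fin 3 → ℝ, ‖∑ i, (u i : ℂ) • e i‖ ^ 2 *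
        f (lineProj (∑ i, (u i : ℂ) • e i).ofLp) = u ⬝ᵥ (B *ᵥ u) := by
      intro u
      rcases eq_or_ne u 0 with rfl | hu
      · simp
      · have h1 : (∑ i, (u i : ℂ) • e i).ofLp = E *ᵥ fun i => (u i : ℂ) := by
          ext a
          simp [E, Matrix.mulVec, dotProduct, mul_comm]
        have h2 : ‖∑ i, (u i : ℂ) • e i‖ ^ 2 = u ⬝ᵥ u := by
          have h := he.inner_sum (fun i => (u i : ℂ)) (fun i => (u i : ℂ)) Finset.univ
          rw [inner_self_eq_norm_sq_to_K] at h
          have h' : ((‖∑ i, (u i : ℂ) • e i‖ ^ 2 : ℝ) : ℂ) = ((u ⬝ᵥ u : ℝ) : ℂ) := by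
            rw [Complex.ofReal_pow]
            refine h.trans ?_
            simp [dotProduct]
          exact_mod_cast h'
        rw [h1, h2, mul_comm]
        exact hB u hu
    refine ⟨‖x‖ ^ 2 * B 0 0, ‖y‖ ^ 2 * B 1 1, ‖z‖ ^ 2 * B 2 2, ‖x‖ * ‖y‖ * (B 0 1 + B 1 0),
      ‖x‖ * ‖z‖ * (B 0 2 + B 2 0), ‖y‖ * ‖z‖ * (B 1 2 + B 2 1), fun s t r => ?_⟩
    have hsum : (s : ℂ) • x + (t : ℂ) • y + (r : ℂ) • z =
        ∑ i, ((![s * ‖x‖, t * ‖y‖, r * ‖z‖] i : ℝ) : ℂ) • e i := by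
      rw [Fin.sum_univ_three]
      conv_lhs => rw [hx, hy, hz]
      simp only [smul_smul, Complex.ofReal_mul, Matrix.cons_val_zero, Matrix.cons_val_one,
        Matrix.cons_val]
    simp only [hsum]
    rw [key]
    simp [Matrix.mulVec, dotProduct, Fin.sum_univ_three]
    ring

/-- A projection measure is given on lines by a Hermitian matrix. -/
theorem exists_isHermitian (hf : IsProjectionMeasure f) (hn : 3 ≤ n) :
    ∃ ρ : Matrix (Fin n) (Fin n) ℂ, ρ.IsHermitian ∧
    ∀ v : Fin n → ℂ, (star v ⬝ᵥ (ρ *ᵥ v)).re = (star v ⬝ᵥ v).re * f (lineProj v) := by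
  obtain ⟨H, hH⟩ := (hf.isLocallyQuadratic hn).exists_matrix (by simpa using hn)
    (EuclideanSpace.basisFun (Fin n) ℂ).orthonormal
  have hre : ∀ v : Fin n → ℂ, (star v ⬝ᵥ (Matrix.of H *ᵥ v)).re =
      (star v ⬝ᵥ v).re * f (lineProj v) := by
    intro v
    have h := hH v
    have e : ∑ i, v i • EuclideanSpace.basisFun (Fin n) ℂ i = WithLp.toLp 2 v := by
      ext a
      simp [Pi.single_apply]
    rw [e] at h
    have e2 : (star v ⬝ᵥ v).re = ‖WithLp.toLp 2 v‖ ^ 2 := by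
      rw [EuclideanSpace.norm_sq_eq]
      simp only [dotProduct, Complex.re_sum, Pi.star_apply]
      refine Finset.sum_congr rfl fun i _ => ?_
      rw [Complex.star_def, ← Complex.normSq_eq_conj_mul_self, Complex.ofReal_re,
        Complex.normSq_eq_norm_sq]
    rw [e2]
    refine Eq.trans ?_ h.symm
    simp only [dotProduct, Matrix.mulVec, Complex.re_sum, Finset.mul_sum, Pi.star_apply,
      Matrix.of_apply]
    refine Finset.sum_congr rfl fun i _ => Finset.sum_congr rfl fun j _ => ?_
    congr 1
    ring
  refine ⟨(2⁻¹ : ℂ) • (Matrix.of H + (Matrix.of H)ᴴ), ?_, fun v => ?_⟩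
  · rw [Matrix.IsHermitian, conjTranspose_smul, conjTranspose_add, conjTranspose_conjTranspose,
      add_comm]
    simp
  · have hconj : star v ⬝ᵥ ((Matrix.of H)ᴴ *ᵥ v) = star (star v ⬝ᵥ (Matrix.of H *ᵥ v)) := by
      rw [star_dotProduct, star_mulVec, conjTranspose_conjTranspose, ← dotProduct_mulVec]
    rw [smul_mulVec, add_mulVec, dotProduct_smul, dotProduct_add, hconj, ← hre]
    simp
    ring

end IsProjectionMeasure

theorem eq_of_re_dotProduct_mulVec_eq {n : ℕ} {A B : Matrix (Fin n) (Fin n) ℂ}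
    (hA : A.IsHermitian) (hB : B.IsHermitian)
    (h : ∀ v : Fin n → ℂ, (star v ⬝ᵥ (A *ᵥ v)).re = (star v ⬝ᵥ (B *ᵥ v)).re) : A = B := by
  apply Matrix.toEuclideanLin.injective
  rw [← ext_inner_map]
  intro x
  have e : ∀ M : Matrix (Fin n) (Fin n) ℂ,
      inner ℂ (Matrix.toEuclideanLin M x) x = star (star x.ofLp ⬝ᵥ (M *ᵥ x.ofLp)) := by
    intro M
    rw [EuclideanSpace.inner_eq_star_dotProduct, ← star_dotProduct, dotProduct_comm]
    rfl
  rw [e, e]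
  congr 1
  refine Complex.ext (h x.ofLp) ?_
  have hA' := hA.im_star_dotProduct_mulVec_self x.ofLp
  have hB' := hB.im_star_dotProduct_mulVec_self x.ofLp
  exact hA'.trans hB'.symm

/-- A normalized projection measure in dimension at least three is given by the Born rule for a
unique density matrix. -/
theorem IsProjectionMeasure.existsUnique {n : ℕ} (hn : 3 ≤ n)
    {f : Matrix (Fin n) (Fin n) ℂ → ℝ} (hf : IsProjectionMeasure f) (hone : f 1 = 1) :
    ∃! ρ : Matrix (Fin n) (Fin n) ℂ, ρ.PosSemidef ∧ ρ.trace = 1 ∧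
      ∀ P : Matrix (Fin n) (Fin n) ℂ, IsStarProjection P → f P = ((ρ * P).trace).re := by
  have hself : ∀ v : Fin n → ℂ, v ≠ 0 →
      0 < (star v ⬝ᵥ v).re ∧ star v ⬝ᵥ v = ((star v ⬝ᵥ v).re : ℂ) := by
    intro v hv
    have h := Complex.pos_iff.1 (dotProduct_star_self_pos_iff.2 hv)
    exact ⟨h.1, Complex.ext (by simp) (by simpa using h.2.symm)⟩
  have htr : ∀ (A : Matrix (Fin n) (Fin n) ℂ) (v : Fin n → ℂ), v ≠ 0 →
      (star v ⬝ᵥ v).re * ((A * lineProj v).trace).re = (star v ⬝ᵥ (A *ᵥ v)).re := by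
    intro A v hv
    obtain ⟨h1, h2⟩ := hself v hv
    rw [trace_mul_lineProj, h2, ← Complex.ofReal_inv, Complex.re_ofReal_mul, Complex.ofReal_re,
      mul_inv_cancel_left₀ h1.ne']
  obtain ⟨ρ, hρ, hform⟩ := hf.exists_isHermitian hn
  have hline : ∀ v : Fin n → ℂ, v ≠ 0 → f (lineProj v) = ((ρ * lineProj v).trace).re := by
    intro v hv
    have h := htr ρ v hv
    rw [hform] at h
    exact (mul_left_cancel₀ (hself v hv).1.ne' h).symm
  have hproj : ∀ P : Matrix (Fin n) (Fin n) ℂ, IsStarProjection P →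
      f P = ((ρ * P).trace).re := by
    intro P hP
    obtain ⟨s, v, hv, hv1, rfl⟩ := exists_eq_sum_lineProj hP
    rw [(hf.sum_lineProj s v hv).2, Matrix.mul_sum, trace_sum, Complex.re_sum]
    refine Finset.sum_congr rfl fun i _ => hline _ ?_
    intro h
    simpa [h] using hv1 i
  refine ⟨ρ, ⟨?_, ?_, hproj⟩, ?_⟩
  · refine .of_dotProduct_mulVec_nonneg hρ fun v => Complex.nonneg_iff.2 ⟨?_, ?_⟩
    · rw [hform]
      exact mul_nonneg (Complex.nonneg_iff.1 (dotProduct_star_self_nonneg v)).1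
        (hf.nonneg _ (isStarProjection_lineProj v))
    · exact (hρ.im_star_dotProduct_mulVec_self v).symm
  · have h1 := hproj 1 (.one _)
    rw [hone, Matrix.mul_one] at h1
    refine Complex.ext h1.symm ?_
    rw [Complex.one_im, ← Complex.conj_eq_iff_im, ← Complex.star_def, ← trace_conjTranspose, hρ.eq]
  · rintro σ ⟨hσ, -, hσf⟩
    refine eq_of_re_dotProduct_mulVec_eq hσ.isHermitian hρ fun v => ?_
    rcases eq_or_ne v 0 with rfl | hv
    · simp
    · rw [← htr σ v hv, ← htr ρ v hv, ← hσf _ (isStarProjection_lineProj v),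
        ← hproj _ (isStarProjection_lineProj v)]

end Gleason

/-- Gleason's theorem, finite-dimensional case: for `n ≥ 3`, every
`[0,1]`-valued, normalized, finitely additive function on the orthogonal projections of
`ℂ^n` is given by the Born rule for a unique density matrix `ρ`. -/
theorem gleason_finite_dim (n : ℕ) (hn : 3 ≤ n)
    (f : Matrix (Fin n) (Fin n) ℂ → ℝ)
    (hbound : ∀ P : Matrix (Fin n) (Fin n) ℂ, Pᴴ = P → P * P = P →
      0 ≤ f P ∧ f P ≤ 1)
    (hone : f (1 : Matrix (Fin n) (Fin n) ℂ) = 1)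
    (hadd : ∀ P Q : Matrix (Fin n) (Fin n) ℂ, Pᴴ = P → P * P = P →
      Qᴴ = Q → Q * Q = Q → P * Q = 0 → f (P + Q) = f P + f Q) :
    ∃! ρ : Matrix (Fin n) (Fin n) ℂ, ρ.PosSemidef ∧ ρ.trace = 1 ∧
      ∀ P : Matrix (Fin n) (Fin n) ℂ, Pᴴ = P → P * P = P →
        f P = ((ρ * P).trace).re := by
  have hf : Gleason.IsProjectionMeasure f :=
    ⟨fun P hP => (hbound P hP.isSelfAdjoint hP.isIdempotentElem).1,
      fun P hP => (hbound P hP.isSelfAdjoint hP.isIdempotentElem).2,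
      fun P Q hP hQ => hadd P Q hP.isSelfAdjoint hP.isIdempotentElem hQ.isSelfAdjoint
        hQ.isIdempotentElem⟩
  obtain ⟨ρ, ⟨hpos, htr, hρ⟩, huniq⟩ := hf.existsUnique hn hone
  exact ⟨ρ, ⟨hpos, htr, fun P h1 h2 => hρ P ⟨h2, h1⟩⟩, fun σ ⟨hσ, hσtr, hσf⟩ =>
    huniq σ ⟨hσ, hσtr, fun P hP => hσf P hP.isSelfAdjoint hP.isIdempotentElem⟩⟩
end

section
/- (Operational purity implies abstract purity.) Let ρ be a density matrix on ℂ^n and let P be an orthogonal projection with trace P = 1 (a rank-one projection). If Re(trace(ρ * P)) = 1, i.e., the test of the corresponding power yields its outcome with certainty (probability 1), then ρ = P; in particular ρ is a pure state (ρ * ρ = ρ). -/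
open Matrix ComplexOrder

/-- The `2 × 2` principal minors of a positive semidefinite matrix are nonnegative. -/
lemma Matrix.PosSemidef.apply_mul_apply_le {m : Type*} {A : Matrix m m ℂ}
    (hA : A.PosSemidef) (i j : m) : A i j * A j i ≤ A i i * A j j := by
  have h := (hA.submatrix ![i, j]).det_nonneg
  rw [det_fin_two] at h
  simpa using h

lemma Matrix.PosSemidef.trace_mul_self_le {m : Type*} [Fintype m] {A : Matrix m m ℂ}
    (hA : A.PosSemidef) : (A * A).trace ≤ A.trace * A.trace := by
  simp only [trace, diag_apply, mul_apply, Finset.sum_mul_sum]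
  exact Finset.sum_le_sum fun i _ ↦ Finset.sum_le_sum fun j _ ↦ hA.apply_mul_apply_le i j

/-- Operational purity implies abstract purity: if a density matrix `ρ`
yields Born intensity `1` on a rank-one orthogonal projection `P` (i.e. `trace P = 1`),
then `ρ = P`; in particular `ρ` is a pure state. -/
theorem operational_purity_implies_abstract_purity (n : ℕ)
    (ρ P : Matrix (Fin n) (Fin n) ℂ)
    (hρ : ρ.PosSemidef) (hρtr : ρ.trace = 1)
    (hP : Pᴴ = P) (hPP : P * P = P) (hPtr : P.trace = 1)
    (h : ((ρ * P).trace).re = 1) :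
    ρ = P ∧ ρ * ρ = ρ := by
  have hsq : ((ρ * ρ).trace).re ≤ 1 := by
    simpa [hρtr] using (Complex.le_def.1 hρ.trace_mul_self_le).1
  have hnonneg := (posSemidef_conjTranspose_mul_self (ρ - P)).trace_nonneg
  have htr : ((ρ - P)ᴴ * (ρ - P)).trace = (ρ * ρ).trace - 2 * (ρ * P).trace + 1 := by
    rw [conjTranspose_sub, hρ.isHermitian.eq, hP, sub_mul, mul_sub, mul_sub, hPP]
    simp only [trace_sub, hPtr, trace_mul_comm P ρ]
    ring
  have hre : (((ρ - P)ᴴ * (ρ - P)).trace).re ≤ 0 := by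
    rw [htr]
    simp only [Complex.add_re, Complex.sub_re, Complex.mul_re, Complex.re_ofNat,
      Complex.im_ofNat, Complex.one_re, h]
    linarith
  have hzero : ((ρ - P)ᴴ * (ρ - P)).trace = 0 :=
    le_antisymm (Complex.le_def.2 ⟨hre, (Complex.le_def.1 hnonneg).2.symm⟩) hnonneg
  have hρP : ρ = P := sub_eq_zero.1 (trace_conjTranspose_mul_self_eq_zero_iff.1 hzero)
  exact ⟨hρP, by rw [hρP, hPP]⟩
end
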